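/- Almost all ξ ∈ F_q((T^{-1})) (with respect to Haar measure) satisfy w_n^*(ξ) = n for every positive integer n. -/

import Mathlib

open Polynomial
open scoped Classical

namespace MahlerKoksmaFq

noncomputable section

variable (Fq : Type) [Field Fq] [Fintype Fq]

/-- `K Fq` models `F_q((T⁻¹))`: Laurent series in the variable `t = T⁻¹`. -/
abbrev K := LaurentSeries Fq

/-- The element `T` (the inverse of the Laurent-series variable `t = T⁻¹`). -/
def Tvar : K Fq := HahnSeries.single (-1 : ℤ) 1

/-- The absolute value `|ξ| = q^{-ν(ξ)}` on `F_q((T⁻¹))`. -/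
def absK (ξ : K Fq) : ℝ :=
  if ξ = 0 then 0 else (Fintype.card Fq : ℝ) ^ (-(HahnSeries.order ξ))

/-- The embedding of `F_q[T]` into `F_q((T⁻¹))`, sending `T` to `Tvar`. -/
def emb : Polynomial Fq →+* K Fq :=
  Polynomial.eval₂RingHom (algebraMap Fq (K Fq)) (Tvar Fq)

/-- Evaluation of `P ∈ F_q[T][X]` at `ξ ∈ F_q((T⁻¹))`. -/
def evalK (P : Polynomial (Polynomial Fq)) (ξ : K Fq) : K Fq :=
  P.eval₂ (emb Fq) ξ

/-- Height of a polynomial over `F_q[T]`: the maximum of the absolute values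
`q^{deg c}` of its coefficients. -/
def HP (P : Polynomial (Polynomial Fq)) : ℝ :=
  (Fintype.card Fq : ℝ) ^ (P.support.sup fun i => (P.coeff i).natDegree)

/-- `ξ` is algebraic (over `F_q[T]`) of degree at most `n`. -/
def IsAlgDegLe (ξ : K Fq) (n : ℕ) : Prop :=
  ∃ P : Polynomial (Polynomial Fq), P ≠ 0 ∧ P.natDegree ≤ n ∧ evalK Fq P ξ = 0

/-- `ξ` is algebraic over `F_q[T]`. -/
def IsAlgK (ξ : K Fq) : Prop :=
  ∃ P : Polynomial (Polynomial Fq), P ≠ 0 ∧ evalK Fq P ξ = 0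

/-- The degree of an algebraic element of `F_q((T⁻¹))`. -/
def degA (α : K Fq) : ℕ :=
  sInf {d | ∃ P : Polynomial (Polynomial Fq), P ≠ 0 ∧ P.natDegree = d ∧ evalK Fq P α = 0}

/-- The height of an algebraic element `α` of `F_q((T⁻¹))`: the least height of a
 nonzero annihilating polynomial of minimal degree (= height of the minimal
 defining polynomial over `F_q[T]`). -/
def HA (α : K Fq) : ℝ :=
  sInf {h | ∃ P : Polynomial (Polynomial Fq),
    P ≠ 0 ∧ P.natDegree = degA Fq α ∧ evalK Fq P α = 0 ∧ h = HP Fq P}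

/-- The defining set for Mahler's exponent `w_n`. -/
def wnSet (ξ : K Fq) (n : ℕ) : Set ℝ :=
  {w | {P : Polynomial (Polynomial Fq) |
      P.natDegree ≤ n ∧ 0 < absK Fq (evalK Fq P ξ) ∧
      absK Fq (evalK Fq P ξ) < HP Fq P ^ (-w)}.Infinite}

/-- Mahler's exponent `w_n(ξ)`. -/
def wn (ξ : K Fq) (n : ℕ) : EReal :=
  sSup ((fun w : ℝ => (w : EReal)) '' wnSet Fq ξ n)

/-- The defining set for `w_n^{sep}` (separable polynomials only). -/
def wnsepSet (ξ : K Fq) (n : ℕ) : Set ℝ :=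
  {w | {P : Polynomial (Polynomial Fq) |
      P.Separable ∧ P.natDegree ≤ n ∧ 0 < absK Fq (evalK Fq P ξ) ∧
      absK Fq (evalK Fq P ξ) < HP Fq P ^ (-w)}.Infinite}

/-- The exponent `w_n^{sep}(ξ)`. -/
def wnsep (ξ : K Fq) (n : ℕ) : EReal :=
  sSup ((fun w : ℝ => (w : EReal)) '' wnsepSet Fq ξ n)

/-- The defining set for Koksma's exponent `w_n^*` (approximation by algebraic
elements lying in `F_q((T⁻¹))`). -/
def wnstarSet (ξ : K Fq) (n : ℕ) : Set ℝ :=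
  {w | {α : K Fq | IsAlgK Fq α ∧ degA Fq α ≤ n ∧ 0 < absK Fq (ξ - α) ∧
      absK Fq (ξ - α) < HA Fq α ^ (-w - 1)}.Infinite}

/-- Koksma's exponent `w_n^*(ξ)`. -/
def wnstar (ξ : K Fq) (n : ℕ) : EReal :=
  sSup ((fun w : ℝ => (w : EReal)) '' wnstarSet Fq ξ n)

/-- The defining set for the uniform exponent `ŵ_n`. -/
def hwnSet (ξ : K Fq) (n : ℕ) : Set ℝ :=
  {w | ∃ H0 : ℝ, ∀ H : ℝ, H0 < H → ∃ P : Polynomial (Polynomial Fq),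
      P.natDegree ≤ n ∧ HP Fq P ≤ H ∧ 0 < absK Fq (evalK Fq P ξ) ∧
      absK Fq (evalK Fq P ξ) < H ^ (-w)}

/-- The uniform exponent `ŵ_n(ξ)`. -/
def hwn (ξ : K Fq) (n : ℕ) : EReal :=
  sSup ((fun w : ℝ => (w : EReal)) '' hwnSet Fq ξ n)

/-- The defining set for the uniform exponent `ŵ_n^{sep}` (separable polynomials only). -/
def hwnsepSet (ξ : K Fq) (n : ℕ) : Set ℝ :=
  {w | ∃ H0 : ℝ, ∀ H : ℝ, H0 < H → ∃ P : Polynomial (Polynomial Fq),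
      P.Separable ∧ P.natDegree ≤ n ∧ HP Fq P ≤ H ∧ 0 < absK Fq (evalK Fq P ξ) ∧
      absK Fq (evalK Fq P ξ) < H ^ (-w)}

/-- The uniform exponent `ŵ_n^{sep}(ξ)`. -/
def hwnsep (ξ : K Fq) (n : ℕ) : EReal :=
  sSup ((fun w : ℝ => (w : EReal)) '' hwnsepSet Fq ξ n)

/-- The fractional part of a Laurent series in `T⁻¹`: the part with only
 negative powers of `T` (positive powers of the series variable `t = T⁻¹`). -/
def fracPart (η : K Fq) : K Fq :=
  { coeff := fun m => if 0 < m then η.coeff m else 0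
    isPWO_support' := η.isPWO_support'.mono (fun m hm => by
      by_cases h : 0 < m
      · simpa [Function.mem_support, h] using hm
      · simp [Function.mem_support, h] at hm) }

/-- The fractional-part norm `‖η‖ = |η - [η]|`. -/
def fracNorm (η : K Fq) : ℝ := absK Fq (fracPart Fq η)

/-- `max{‖R(T)ξ‖, …, ‖R(T)ξⁿ‖}`. -/
def maxFrac (ξ : K Fq) (n : ℕ) (R : Polynomial Fq) : ℝ :=
  sSup ((fun i => fracNorm Fq (emb Fq R * ξ ^ i)) '' Set.Icc 1 n)

/-- The defining set for the exponent of simultaneous approximation `λ_n`. -/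
def lamSet (ξ : K Fq) (n : ℕ) : Set ℝ :=
  {l | {R : Polynomial Fq | 0 < maxFrac Fq ξ n R ∧
      maxFrac Fq ξ n R < (Fintype.card Fq : ℝ) ^ (-(l * R.natDegree))}.Infinite}

/-- The exponent of simultaneous approximation `λ_n(ξ)`. -/
def lam (ξ : K Fq) (n : ℕ) : EReal :=
  sSup ((fun w : ℝ => (w : EReal)) '' lamSet Fq ξ n)

/-- The defining set for the uniform exponent `λ̂_n`. -/
def hlamSet (ξ : K Fq) (n : ℕ) : Set ℝ :=
  {l | ∃ d0 : ℕ, ∀ d : ℕ, d0 < d → ∃ R : Polynomial Fq, R.natDegree ≤ d ∧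
      0 < maxFrac Fq ξ n R ∧
      maxFrac Fq ξ n R < (Fintype.card Fq : ℝ) ^ (-(l * d))}

/-- The uniform exponent `λ̂_n(ξ)`. -/
def hlam (ξ : K Fq) (n : ℕ) : EReal :=
  sSup ((fun w : ℝ => (w : EReal)) '' hlamSet Fq ξ n)

/-- An algebraic closure of `F_q((T⁻¹))`; its algebraic elements are exactly the
algebraic elements of the completion `C_∞`. -/
abbrev Kbar := AlgebraicClosure (K Fq)

/-- The embedding of `F_q[T]` into the algebraic closure. -/
def embbar : Polynomial Fq →+* Kbar Fq :=
  (algebraMap (K Fq) (Kbar Fq)).comp (emb Fq)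

/-- Evaluation of `P ∈ F_q[T][X]` at a point of the algebraic closure. -/
def evalKbar (P : Polynomial (Polynomial Fq)) (x : Kbar Fq) : Kbar Fq :=
  P.eval₂ (embbar Fq) x

/-- The unique extension of the absolute value of `F_q((T⁻¹))` to its algebraic
closure: `|x| = |N(x)|^{1/d} = |a_0|^{1/d}` where `a_0` is the constant term and
`d` the degree of the minimal polynomial of `x` over `F_q((T⁻¹))`. -/
def absC (x : Kbar Fq) : ℝ :=
  absK Fq ((minpoly (K Fq) x).coeff 0) ^ ((1 : ℝ) / (minpoly (K Fq) x).natDegree)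

/-- `x ∈ C_∞` is algebraic over `F_q[T]`. -/
def IsAlgKbar (x : Kbar Fq) : Prop :=
  ∃ P : Polynomial (Polynomial Fq), P ≠ 0 ∧ evalKbar Fq P x = 0

/-- Degree over `F_q[T]` of an algebraic element of `C_∞`. -/
def degAbar (x : Kbar Fq) : ℕ :=
  sInf {d | ∃ P : Polynomial (Polynomial Fq), P ≠ 0 ∧ P.natDegree = d ∧ evalKbar Fq P x = 0}

/-- Height of an algebraic element of `C_∞`. -/
def HAbar (x : Kbar Fq) : ℝ :=
  sInf {h | ∃ P : Polynomial (Polynomial Fq),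
    P ≠ 0 ∧ P.natDegree = degAbar Fq x ∧ evalKbar Fq P x = 0 ∧ h = HP Fq P}

/-- The defining set for the exponent `w_n^@` (approximation by algebraic
elements of `C_∞`). -/
def wnAtSet (ξ : K Fq) (n : ℕ) : Set ℝ :=
  {w | {α : Kbar Fq | IsAlgKbar Fq α ∧ degAbar Fq α ≤ n ∧
      0 < absC Fq (algebraMap (K Fq) (Kbar Fq) ξ - α) ∧
      absC Fq (algebraMap (K Fq) (Kbar Fq) ξ - α) < HAbar Fq α ^ (-w - 1)}.Infinite}

/-- The exponent `w_n^@(ξ)`. -/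
def wnAt (ξ : K Fq) (n : ℕ) : EReal :=
  sSup ((fun w : ℝ => (w : EReal)) '' wnAtSet Fq ξ n)

/-- The defining set for the uniform exponent `ŵ_n^@`. -/
def hwnAtSet (ξ : K Fq) (n : ℕ) : Set ℝ :=
  {w | ∃ H0 : ℝ, ∀ H : ℝ, H0 < H → ∃ α : Kbar Fq, IsAlgKbar Fq α ∧ degAbar Fq α ≤ n ∧
      HAbar Fq α ≤ H ∧ 0 < absC Fq (algebraMap (K Fq) (Kbar Fq) ξ - α) ∧
      absC Fq (algebraMap (K Fq) (Kbar Fq) ξ - α) < (HAbar Fq α)⁻¹ * H ^ (-w)}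

/-- The uniform exponent `ŵ_n^@(ξ)`. -/
def hwnAt (ξ : K Fq) (n : ℕ) : EReal :=
  sSup ((fun w : ℝ => (w : EReal)) '' hwnAtSet Fq ξ n)

/-- `w(ξ) = limsup_n w_n(ξ)/n`. -/
def wlim (ξ : K Fq) : EReal :=
  Filter.atTop.limsup fun n : ℕ => wn Fq ξ n * (((n : ℝ)⁻¹ : ℝ) : EReal)

/-- `w^*(ξ) = limsup_n w_n^*(ξ)/n`. -/
def wlimstar (ξ : K Fq) : EReal :=
  Filter.atTop.limsup fun n : ℕ => wnstar Fq ξ n * (((n : ℝ)⁻¹ : ℝ) : EReal)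

/-- Height of a polynomial over `C_∞`: maximum of the absolute values of its
coefficients. -/
def HC (P : Polynomial (Kbar Fq)) : ℝ :=
  sSup ((fun i => absC Fq (P.coeff i)) '' Set.Iic P.natDegree)



section
variable {Fq}

/-- Cardinality of the field as a real. -/
def qq (Fq : Type) [Fintype Fq] : ℝ := (Fintype.card Fq : ℝ)

lemma one_lt_qq : (1 : ℝ) < qq Fq := by
  unfold qq
  exact_mod_cast Fintype.one_lt_card

lemma qq_pos : (0 : ℝ) < qq Fq := lt_trans one_pos one_lt_qq

lemma absK_zero : absK Fq 0 = 0 := by simp [absK]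

lemma absK_of_ne {x : K Fq} (h : x ≠ 0) : absK Fq x = qq Fq ^ (-(HahnSeries.order x)) := by
  simp [absK, h, qq]

lemma absK_pos {x : K Fq} (h : x ≠ 0) : 0 < absK Fq x := by
  rw [absK_of_ne h]; exact zpow_pos qq_pos _

lemma absK_nonneg (x : K Fq) : 0 ≤ absK Fq x := by
  by_cases h : x = 0
  · simp [h, absK_zero]
  · exact (absK_pos h).le

lemma absK_eq_zero {x : K Fq} : absK Fq x = 0 ↔ x = 0 := by
  constructor
  · intro h; by_contra hx; exact (absK_pos hx).ne' h
  · rintro rfl; exact absK_zero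

lemma absK_mul (x y : K Fq) : absK Fq (x * y) = absK Fq x * absK Fq y := by
  by_cases hx : x = 0
  · simp [hx, absK_zero]
  by_cases hy : y = 0
  · simp [hy, absK_zero]
  rw [absK_of_ne hx, absK_of_ne hy, absK_of_ne (mul_ne_zero hx hy), HahnSeries.order_mul hx hy,
    ← zpow_add₀ qq_pos.ne']
  congr 1; ring

lemma absK_add_le (x y : K Fq) : absK Fq (x + y) ≤ max (absK Fq x) (absK Fq y) := by
  by_cases hx : x = 0
  · simp [hx]
  by_cases hy : y = 0
  · simp [hy]
  by_cases hxy : x + y = 0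
  · rw [hxy, absK_zero]; exact le_max_of_le_left (absK_nonneg _)
  rw [absK_of_ne hx, absK_of_ne hy, absK_of_ne hxy]
  have h := HahnSeries.min_order_le_order_add hxy
  rcases min_le_iff.1 h with h | h
  · exact le_max_of_le_left (zpow_le_zpow_right₀ one_lt_qq.le (by omega))
  · exact le_max_of_le_right (zpow_le_zpow_right₀ one_lt_qq.le (by omega))

/-- The absolute value, bundled. -/
def absV : AbsoluteValue (K Fq) ℝ where
  toFun := absK Fq
  map_mul' := absK_mul
  nonneg' := absK_nonneg
  eq_zero' _ := absK_eq_zero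
  add_le' x y := (absK_add_le x y).trans
    (max_le (le_add_of_nonneg_right (absK_nonneg _)) (le_add_of_nonneg_left (absK_nonneg _)))

lemma absV_apply (x : K Fq) : absV x = absK Fq x := rfl

lemma absK_one : absK Fq 1 = 1 := map_one (absV (Fq := Fq))
lemma absK_neg (x : K Fq) : absK Fq (-x) = absK Fq x := map_neg_eq_map (absV (Fq := Fq)) x
lemma absK_sub_comm (x y : K Fq) : absK Fq (x - y) = absK Fq (y - x) := map_sub_rev (absV (Fq := Fq)) x y
lemma absK_pow (x : K Fq) (n : ℕ) : absK Fq (x ^ n) = absK Fq x ^ n := map_pow (absV (Fq := Fq)) x n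
lemma absK_zpow (x : K Fq) (n : ℤ) : absK Fq (x ^ n) = absK Fq x ^ n := map_zpow₀ (absV (Fq := Fq)) x n
lemma absK_inv (x : K Fq) : absK Fq (x⁻¹) = (absK Fq x)⁻¹ := map_inv₀ (absV (Fq := Fq)) x
lemma absK_div (x y : K Fq) : absK Fq (x / y) = absK Fq x / absK Fq y := map_div₀ (absV (Fq := Fq)) x y
lemma absK_prod {ι : Type*} (s : Finset ι) (f : ι → K Fq) :
    absK Fq (∏ i ∈ s, f i) = ∏ i ∈ s, absK Fq (f i) := map_prod (absV (Fq := Fq)) f s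

lemma absK_sub_le (x y : K Fq) : absK Fq (x - y) ≤ max (absK Fq x) (absK Fq y) := by
  rw [sub_eq_add_neg, ← absK_neg y]; exact absK_add_le _ _

lemma absK_sum_le {ι : Type*} (s : Finset ι) (f : ι → K Fq) {C : ℝ} (hC : 0 ≤ C)
    (h : ∀ i ∈ s, absK Fq (f i) ≤ C) : absK Fq (∑ i ∈ s, f i) ≤ C := by
  induction s using Finset.induction_on with
  | empty => simpa [absK_zero] using hC
  | insert a s ha ih =>
    rw [Finset.sum_insert ha]
    exact (absK_add_le _ _).trans (max_le (h a (by simp)) (ih fun i hi => h i (by simp [hi])))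

lemma absK_sum_lt {ι : Type*} (s : Finset ι) (f : ι → K Fq) {C : ℝ} (hC : 0 < C)
    (h : ∀ i ∈ s, absK Fq (f i) < C) : absK Fq (∑ i ∈ s, f i) < C := by
  induction s using Finset.induction_on with
  | empty => simpa [absK_zero] using hC
  | insert a s ha ih =>
    rw [Finset.sum_insert ha]
    exact (absK_add_le _ _).trans_lt (max_lt (h a (by simp)) (ih fun i hi => h i (by simp [hi])))

lemma absK_add_eq {x y : K Fq} (h : absK Fq y < absK Fq x) : absK Fq (x + y) = absK Fq x := by
  apply le_antisymm
  · exact (absK_add_le x y).trans (max_le le_rfl h.le)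
  · by_contra hc
    push Not at hc
    have := absK_sub_le (x + y) y
    rw [add_sub_cancel_right] at this
    exact absurd this (not_le.2 (max_lt hc h))

/-- The ball of radius `q^{-k}`. -/
def UU (k : ℤ) : AddSubgroup (K Fq) where
  carrier := {x | ∀ m < k, x.coeff m = 0}
  add_mem' := by intro a b ha hb m hm; simp [ha m hm, hb m hm]
  zero_mem' := by intro m _; simp
  neg_mem' := by intro a ha m hm; simp [ha m hm]

lemma mem_UU {k : ℤ} {x : K Fq} : x ∈ UU k ↔ ∀ m < k, x.coeff m = 0 := Iff.rfl

lemma mem_UU_iff {k : ℤ} {x : K Fq} : x ∈ UU k ↔ absK Fq x ≤ qq Fq ^ (-k) := by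
  by_cases hx : x = 0
  · simp only [hx, absK_zero, zero_mem, true_iff]; exact (zpow_pos qq_pos _).le
  · rw [mem_UU, ← HahnSeries.le_order_iff_forall hx, absK_of_ne hx,
      zpow_le_zpow_iff_right₀ one_lt_qq]
    omega

lemma mem_UU_succ_iff {k : ℤ} {x : K Fq} : x ∈ UU (k + 1) ↔ absK Fq x < qq Fq ^ (-k) := by
  by_cases hx : x = 0
  · simp only [hx, absK_zero, zero_mem, true_iff]; exact (zpow_pos qq_pos _)
  · rw [mem_UU, ← HahnSeries.le_order_iff_forall hx, absK_of_ne hx,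
      zpow_lt_zpow_iff_right₀ one_lt_qq]
    omega

lemma UU_mono {k l : ℤ} (h : k ≤ l) : (UU l : AddSubgroup (K Fq)) ≤ UU k :=
  fun _ hx m hm => hx m (lt_of_lt_of_le hm h)

lemma UU_eq_val (k : ℤ) : ((UU k : AddSubgroup (K Fq)) : Set (K Fq)) =
    {x | Valued.v x ≤ WithZero.exp (-k : ℤ)} := by
  ext x
  simp only [SetLike.mem_coe, mem_UU, Set.mem_ofPred_eq]
  rw [LaurentSeries.valuation_le_iff_coeff_lt_eq_zero]

lemma UU_nhds_exists {s : Set (K Fq)} (hs : s ∈ nhds (0 : K Fq)) : ∃ k : ℕ, ((UU (k : ℤ) : AddSubgroup (K Fq)) : Set (K Fq)) ⊆ s := by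
  obtain ⟨γ, hU₁⟩ := Valued.mem_nhds_zero.mp hs
  set D := -(WithZero.log (MonoidWithZeroHom.ValueGroup₀.embedding γ.1) - 1) with hD₀
  have hD : WithZero.exp (-D) < MonoidWithZeroHom.ValueGroup₀.embedding γ.1 := by
    rw [← WithZero.lt_log_iff_exp_lt (by simp), hD₀]
    simp
  refine ⟨D.toNat, fun x hx => hU₁ ?_⟩
  have hx' : x ∈ ((UU D : AddSubgroup (K Fq)) : Set (K Fq)) := UU_mono (Int.self_le_toNat D) hx
  rw [UU_eq_val] at hx'
  simp only [Set.mem_ofPred_eq] at hx' ⊢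
  rw [Valued.v.restrict_lt_iff_lt_embedding]
  exact lt_of_le_of_lt hx' hD

lemma UU_mem_nhds (k : ℤ) : ((UU k : AddSubgroup (K Fq)) : Set (K Fq)) ∈ nhds (0 : K Fq) := by
  rw [UU_eq_val]
  have h : Valued.v (HahnSeries.single k (1 : Fq) : K Fq) = WithZero.exp (-k) := LaurentSeries.valuation_single_zpow Fq k
  have hne : (Valued.v (R := K Fq)).restrict (HahnSeries.single k (1 : Fq) : K Fq) ≠ 0 := by
    rw [ne_eq, ← map_zero (Valued.v (R := K Fq)).restrict, Valuation.restrict_inj, map_zero, h]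
    exact WithZero.exp_ne_zero
  refine Valued.mem_nhds_zero.mpr ⟨Units.mk0 _ hne, fun x hx => ?_⟩
  have hx' : (Valued.v (R := K Fq)).restrict x < (Valued.v (R := K Fq)).restrict (HahnSeries.single k (1 : Fq) : K Fq) := hx
  rw [Valuation.restrict_lt_iff, h] at hx'
  exact hx'.le

lemma isOpen_UU (k : ℤ) : IsOpen ((UU k : AddSubgroup (K Fq)) : Set (K Fq)) :=
  AddSubgroup.isOpen_of_mem_nhds _ (UU_mem_nhds k)

/-- Coset balls. -/
def BB (c : K Fq) (k : ℤ) : Set (K Fq) := {x | x - c ∈ (UU k : AddSubgroup (K Fq))}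

lemma BB_eq (c : K Fq) (k : ℤ) : BB c k = (fun x => x + (-c)) ⁻¹' (UU k : AddSubgroup (K Fq)) := by
  ext x; simp [BB, sub_eq_add_neg]

lemma mem_BB_self (c : K Fq) (k : ℤ) : c ∈ BB c k := by simp [BB]

lemma BB_eq_of_mem {c d : K Fq} {k : ℤ} (h : d ∈ BB c k) : BB d k = BB c k := by
  ext x
  simp only [BB, Set.mem_ofPred_eq] at *
  constructor
  · intro hx; simpa using add_mem hx h
  · intro hx; simpa using sub_mem hx h

lemma BB_mono (c : K Fq) {k l : ℤ} (h : k ≤ l) : BB c l ⊆ BB c k := fun _ hx => UU_mono h hx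

lemma isOpen_BB (c : K Fq) (k : ℤ) : IsOpen (BB c k) := by
  rw [BB_eq]; exact (isOpen_UU k).preimage (continuous_add_const _)

lemma BB_zero (k : ℤ) : BB (0 : K Fq) k = (UU k : AddSubgroup (K Fq)) := by
  ext; simp [BB]

lemma mem_nhds_iff_BB {s : Set (K Fq)} {x : K Fq} : s ∈ nhds x ↔ ∃ k : ℕ, BB x k ⊆ s := by
  constructor
  · intro hs
    have : (fun y => y + x) ⁻¹' s ∈ nhds (0 : K Fq) :=
      (continuous_add_const x).continuousAt.preimage_mem_nhds (by simpa using hs)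
    obtain ⟨k, hk⟩ := UU_nhds_exists this
    refine ⟨k, fun y hy => ?_⟩
    have := hk hy
    simpa using this
  · rintro ⟨k, hk⟩
    exact Filter.mem_of_superset ((isOpen_BB x k).mem_nhds (mem_BB_self x k)) hk

lemma exists_qq_zpow_lt {r : ℝ} (hr : 0 < r) : ∃ k : ℕ, qq Fq ^ (-(k : ℤ)) < r := by
  obtain ⟨k, hk⟩ := exists_pow_lt_of_lt_one hr (inv_lt_one_of_one_lt₀ (one_lt_qq (Fq := Fq)))
  refine ⟨k, ?_⟩
  rw [zpow_neg, zpow_natCast, ← inv_pow]; exact hk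

lemma continuous_absK : Continuous (absK Fq) := by
  rw [continuous_iff_continuousAt]
  intro x
  rw [ContinuousAt, Metric.tendsto_nhds]
  intro r hr
  obtain ⟨k, hk⟩ := exists_qq_zpow_lt (Fq := Fq) hr
  rw [Filter.Eventually, mem_nhds_iff_BB]
  refine ⟨k, fun y hy => ?_⟩
  have h1 : absK Fq (y - x) ≤ _ := mem_UU_iff.1 hy
  have h2 : |absV y - absV x| ≤ absV (y - x) := by
    simpa using AbsoluteValue.abs_abv_sub_le_abv_sub (absV (Fq := Fq)) y x
  rw [Set.mem_ofPred_eq, Real.dist_eq]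
  exact lt_of_le_of_lt h2 (lt_of_le_of_lt h1 hk)

/-- The coefficient parametrization of `UU k`. -/
def ofDigits (k : ℤ) (a : ℕ → Fq) : K Fq :=
  HahnSeries.single k 1 * HahnSeries.ofPowerSeries ℤ Fq (PowerSeries.mk a)

lemma coeff_ofDigits (k : ℤ) (a : ℕ → Fq) (i : ℕ) : (ofDigits k a).coeff (k + i) = a i := by
  unfold ofDigits
  rw [add_comm, HahnSeries.coeff_single_mul_add, HahnSeries.ofPowerSeries_apply_coeff]
  simp

lemma coeff_ofDigits_lt (k : ℤ) (a : ℕ → Fq) (m : ℤ) (h : m < k) : (ofDigits k a).coeff m = 0 := by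
  unfold ofDigits
  have : m = (m - k) + k := by ring
  rw [this, HahnSeries.coeff_single_mul_add, one_mul]
  have h2 := PowerSeries.coeff_coe (PowerSeries.mk a) (m - k)
  rw [if_pos (by omega)] at h2
  exact h2

lemma isCompact_UU (k : ℤ) : IsCompact ((UU k : AddSubgroup (K Fq)) : Set (K Fq)) := by
  let _ : TopologicalSpace Fq := ⊥
  have : DiscreteTopology Fq := ⟨rfl⟩
  have hc : Continuous (ofDigits k : (ℕ → Fq) → K Fq) := by
    rw [continuous_iff_continuousAt]
    intro a s hs
    obtain ⟨l, hl⟩ := mem_nhds_iff_BB.1 hs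
    have hopen : ∀ᶠ b in nhds a, ∀ i ∈ Finset.range (l - k).toNat, b i = a i := by
      rw [Filter.eventually_all_finset]
      intro i _
      have : Filter.Tendsto (fun b : ℕ → Fq => b i) (nhds a) (nhds (a i)) := (continuous_apply i).continuousAt
      rw [nhds_discrete Fq] at this
      exact this (show {a i} ∈ pure (a i) from rfl)
    rw [Filter.mem_map]
    refine Filter.mem_of_superset hopen fun b hb => ?_
    apply hl
    intro m hm
    rw [HahnSeries.coeff_sub, sub_eq_zero]
    by_cases hmk : m < k
    · rw [coeff_ofDigits_lt _ _ _ hmk, coeff_ofDigits_lt _ _ _ hmk]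
    · obtain ⟨i, hi⟩ := Int.eq_ofNat_of_zero_le (a := m - k) (by omega)
      have : m = k + i := by omega
      rw [this, coeff_ofDigits, coeff_ofDigits]
      exact hb i (by simp; omega)
  have : ((UU k : AddSubgroup (K Fq)) : Set (K Fq)) = Set.range (ofDigits k) := by
    ext x
    constructor
    · intro hx
      refine ⟨fun i => x.coeff (k + i), ?_⟩
      ext m
      by_cases hmk : m < k
      · rw [coeff_ofDigits_lt _ _ _ hmk, hx m hmk]
      · obtain ⟨i, hi⟩ := Int.eq_ofNat_of_zero_le (a := m - k) (by omega)
        have : m = k + i := by omega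
        rw [this, coeff_ofDigits]
    · rintro ⟨a, rfl⟩ m hm
      exact coeff_ofDigits_lt _ _ _ hm
  rw [this]
  exact isCompact_range hc

section Meas

open MeasureTheory

variable [MeasurableSpace (K Fq)] [BorelSpace (K Fq)] (mu : Measure (K Fq)) [mu.IsAddHaarMeasure]

lemma measurable_BB (c : K Fq) (k : ℤ) : MeasurableSet (BB c k) := (isOpen_BB c k).measurableSet

lemma mu_BB (c : K Fq) (k : ℤ) : mu (BB c k) = mu (BB 0 k) := by
  rw [BB_eq, measure_preimage_add_right, BB_zero]

lemma mu_BB_ne_top (c : K Fq) (k : ℤ) : mu (BB c k) ≠ ⊤ := by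
  rw [mu_BB, BB_zero]; exact (isCompact_UU k).measure_lt_top.ne

lemma mu_BB_pos (c : K Fq) (k : ℤ) : 0 < mu (BB c k) :=
  (isOpen_BB c k).measure_pos mu ⟨c, mem_BB_self c k⟩

lemma BB_disjoint_or_eq (c d : K Fq) (k : ℤ) : Disjoint (BB c k) (BB d k) ∨ BB c k = BB d k := by
  by_cases h : Disjoint (BB c k) (BB d k)
  · exact Or.inl h
  · rw [Set.not_disjoint_iff] at h
    obtain ⟨x, h1, h2⟩ := h
    right
    rw [← BB_eq_of_mem h1, ← BB_eq_of_mem h2]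

lemma mu_BB_succ (k : ℤ) : mu (BB 0 k) = (Fintype.card Fq : ENNReal) * mu (BB 0 (k + 1)) := by
  have h : BB (0 : K Fq) k = ⋃ a : Fq, BB (HahnSeries.single k a) (k + 1) := by
    ext x
    simp only [BB_zero, Set.mem_iUnion, SetLike.mem_coe]
    constructor
    · intro hx
      refine ⟨x.coeff k, fun m hm => ?_⟩
      rcases lt_or_eq_of_le (Int.lt_add_one_iff.1 hm) with h | h
      · simp [hx m h, HahnSeries.coeff_single_of_ne h.ne]
      · subst h; simp
    · rintro ⟨a, ha⟩ m hm
      have := ha m (by omega)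
      simpa [HahnSeries.coeff_single_of_ne hm.ne] using this
  rw [h, measure_iUnion]
  · simp_rw [mu_BB mu (HahnSeries.single k _)]
    rw [tsum_fintype]
    simp
  · intro a b hab
    rcases BB_disjoint_or_eq (HahnSeries.single k a : K Fq) (HahnSeries.single k b) (k + 1) with h | h
    · exact h
    · exfalso
      have h1 : (HahnSeries.single k a : K Fq) ∈ BB (HahnSeries.single k b : K Fq) (k + 1) := by
        rw [← h]; exact mem_BB_self _ _
      have := h1 k (by omega)
      simp [sub_eq_zero] at this
      exact hab this
  · intro a; exact measurable_BB _ _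

lemma mu_BB_add (k : ℤ) (l : ℕ) :
    mu (BB 0 k) = (Fintype.card Fq : ENNReal) ^ l * mu (BB 0 (k + l)) := by
  induction l with
  | zero => simp
  | succ l ih =>
    rw [ih, mu_BB_succ mu (k + l), pow_succ, mul_assoc]
    push_cast
    rw [add_assoc]

lemma card_ne_zero' : (Fintype.card Fq : ENNReal) ≠ 0 := by simp

lemma mu_BB_add' (k : ℤ) (l : ℕ) :
    mu (BB 0 (k + l)) = ((Fintype.card Fq : ENNReal) ^ l)⁻¹ * mu (BB 0 k) := by
  rw [mu_BB_add mu k l, ← mul_assoc, ENNReal.inv_mul_cancel, one_mul]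
  · exact pow_ne_zero _ card_ne_zero'
  · exact ENNReal.pow_ne_top (ENNReal.natCast_ne_top _)

/-- Ultrametric covering lemma. -/
lemma covering (E : Set (K Fq)) (c : K Fq) (k : ℤ) (hE : E ⊆ BB c k) (C : ENNReal)
    (h : ∀ x ∈ E, ∃ j : ℕ, mu (E ∩ BB x (k + j)) ≤ C * mu (BB x (k + j))) :
    mu E ≤ C * mu (BB c k) := by
  let jj : E → ℕ := fun x => Nat.find (h x.1 x.2)
  have hjj : ∀ x : E, mu (E ∩ BB x.1 (k + jj x)) ≤ C * mu (BB x.1 (k + jj x)) := fun x => Nat.find_spec (h x.1 x.2)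
  let T : Set (Set (K Fq)) := Set.range fun x : E => BB x.1 (k + jj x)
  have key : ∀ x y : E, jj x ≤ jj y → ¬ Disjoint (BB x.1 (k + jj x)) (BB y.1 (k + jj y)) →
      BB x.1 (k + jj x) = BB y.1 (k + jj y) := by
    intro x y hxy hd
    rw [Set.not_disjoint_iff] at hd
    obtain ⟨z, h1, h2⟩ := hd
    have h3 : BB y.1 (k + jj x) = BB x.1 (k + jj x) := by
      rw [← BB_eq_of_mem h1, ← BB_eq_of_mem (BB_mono y.1 (by omega : k + (jj x : ℤ) ≤ k + jj y) h2)]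
    have h4 : jj y ≤ jj x := Nat.find_min' (h y.1 y.2) (by rw [h3]; exact hjj x)
    have h5 : jj x = jj y := le_antisymm hxy h4
    rw [← h5, h3]
  have hdisj : T.PairwiseDisjoint id := by
    rintro _ ⟨x, rfl⟩ _ ⟨y, rfl⟩ hne
    by_contra hd
    simp only [Function.onFun, id] at hd
    rcases le_total (jj x) (jj y) with hl | hl
    · exact hne (key x y hl hd)
    · exact hne (key y x hl (fun h => hd h.symm)).symm
  have hsub : ∀ t ∈ T, t ⊆ BB c k := by
    rintro _ ⟨x, rfl⟩
    rw [← BB_eq_of_mem (hE x.2)]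
    exact BB_mono _ (by omega)
  have hmeas : ∀ t ∈ T, MeasurableSet t := by
    rintro _ ⟨x, rfl⟩; exact measurable_BB _ _
  have hcount : T.Countable := by
    have := Measure.countable_meas_pos_of_disjoint_of_meas_iUnion_ne_top (ι := T) mu (As := fun t => t.1)
      (fun t => hmeas t.1 t.2) (fun s t hst => hdisj s.2 t.2 (fun h => hst (Subtype.ext h)))
      (ne_top_of_le_ne_top (mu_BB_ne_top mu c k) (measure_mono (Set.iUnion_subset fun t => hsub t.1 t.2)))
    have h2 : {i : T | 0 < mu i.1} = Set.univ := by
      ext ⟨t, ht⟩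
      obtain ⟨x, rfl⟩ := ht
      simp [mu_BB_pos]
    rw [h2] at this
    exact Set.countable_coe_iff.1 (Set.countable_univ_iff.1 this)
  calc mu E ≤ mu (⋃ t ∈ T, E ∩ t) := by
        apply measure_mono
        intro x hx
        simp only [Set.mem_iUnion]
        exact ⟨_, ⟨⟨x, hx⟩, rfl⟩, hx, mem_BB_self _ _⟩
    _ ≤ ∑' t : T, mu (E ∩ t.1) := measure_biUnion_le mu hcount _
    _ ≤ ∑' t : T, C * mu t.1 := by
        apply ENNReal.tsum_le_tsum
        rintro ⟨t, x, rfl⟩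
        exact hjj x
    _ = C * ∑' t : T, mu t.1 := ENNReal.tsum_mul_left
    _ = C * mu (⋃ t ∈ T, t) := by
        exact congrArg (C * ·) (measure_biUnion hcount hdisj hmeas).symm
    _ ≤ C * mu (BB c k) := by
        gcongr
        exact Set.iUnion₂_subset hsub

end Meas

section Good

open MeasureTheory

lemma lag_eval (f : (K Fq)[X]) (D : ℕ) (hf : f.natDegree ≤ D) (S : Finset (K Fq)) (hS : S.card = D + 1)
    (c : K Fq) (k : ℤ) (l : ℕ) (hSB : ∀ x ∈ S, x ∈ BB c k)
    (hsep : ∀ x ∈ S, ∀ y ∈ S, x ≠ y → x - y ∉ (UU (k + l) : AddSubgroup (K Fq)))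
    (e : ℝ) (he : 0 < e) (hfe : ∀ x ∈ S, absK Fq (f.eval x) < e) (y : K Fq) (hy : y ∈ BB c k) :
    absK Fq (f.eval y) < e * qq Fq ^ (l * D) := by
  have hdeg : f.degree < (S.card : WithBot ℕ) := by
    rw [hS]; exact lt_of_le_of_lt (Polynomial.degree_le_of_natDegree_le hf) (by exact_mod_cast Nat.lt_succ_self D)
  have hInterp := Lagrange.eq_interpolate (s := S) (v := id) (Function.injective_id.injOn) hdeg
  rw [hInterp, Lagrange.interpolate_apply, Polynomial.eval_finsetSum]
  have hq := qq_pos (Fq := Fq)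
  apply absK_sum_lt _ _ (by positivity)
  intro x hx
  rw [Polynomial.eval_mul, Polynomial.eval_C, absK_mul, Lagrange.basis, Polynomial.eval_prod, absK_prod]
  have h1 : ∏ j ∈ S.erase x, absK Fq ((Lagrange.basisDivisor (id x) (id j)).eval y) ≤ qq Fq ^ (l * D) := by
    have hc : (S.erase x).card = D := by rw [Finset.card_erase_of_mem hx, hS]; rfl
    calc _ ≤ ∏ j ∈ S.erase x, qq Fq ^ l := by
          apply Finset.prod_le_prod (fun _ _ => absK_nonneg _)
          intro j hj
          rw [Finset.mem_erase] at hj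
          have h2 := hsep x hx j hj.2 (Ne.symm hj.1)
          rw [mem_UU_iff, not_le] at h2
          have h3 : absK Fq (y - j) ≤ qq Fq ^ (-k) := by
            rw [← mem_UU_iff]
            have : BB j k = BB c k := BB_eq_of_mem (hSB j hj.2)
            rw [← this] at hy; exact hy
          simp only [Lagrange.basisDivisor, id, Polynomial.eval_mul, Polynomial.eval_C, Polynomial.eval_sub, Polynomial.eval_X, absK_mul, absK_inv]
          have h4 : (qq Fq ^ (-(k + l : ℤ)))  * qq Fq ^ l = qq Fq ^ (-k) := by
            rw [← zpow_natCast, ← zpow_add₀ hq.ne']; congr 1; ring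
          have h5 : 0 < absK Fq (x - j) := lt_trans (by positivity) h2
          rw [inv_mul_le_iff₀ h5]
          calc _ ≤ _ := h3
            _ = _ := h4.symm
            _ ≤ _ := by gcongr
      _ = qq Fq ^ (l * D) := by rw [Finset.prod_const, hc, pow_mul]
  calc _ ≤ absK Fq (f.eval x) * qq Fq ^ (l * D) := mul_le_mul_of_nonneg_left h1 (absK_nonneg _)
    _ < _ := by gcongr; exact hfe x hx

variable [MeasurableSpace (K Fq)] [BorelSpace (K Fq)] (mu : Measure (K Fq)) [mu.IsAddHaarMeasure]

lemma good_poly (f : (K Fq)[X]) (D : ℕ) (hf : f.natDegree ≤ D) (c : K Fq) (k : ℤ) (l : ℕ)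
    (e r : ℝ) (he : 0 < e) (hr : e * qq Fq ^ (l * D) ≤ r) (y : K Fq) (hy : y ∈ BB c k)
    (hfy : r ≤ absK Fq (f.eval y)) :
    mu {x | x ∈ BB c k ∧ absK Fq (f.eval x) < e} ≤
      D * ((Fintype.card Fq : ENNReal) ^ l)⁻¹ * mu (BB 0 k) := by
  set E := {x | x ∈ BB c k ∧ absK Fq (f.eval x) < e} with hE
  set T : Set (Set (K Fq)) := (fun x => BB x (k + l)) '' E with hT
  have hTc : T.encard ≤ D := by
    by_contra hcon
    push Not at hcon
    have h1 : ((D + 1 : ℕ) : ℕ∞) ≤ T.encard := by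
      push_cast
      exact Order.add_one_le_of_lt hcon
    obtain ⟨T', hT', hc⟩ := Set.exists_subset_encard_eq h1
    have hfin : T'.Finite := Set.finite_of_encard_eq_coe hc
    have hch : ∀ t : T', ∃ x ∈ E, BB x (k + l) = t.1 := fun t => hT' t.2
    choose g hg1 hg2 using hch
    have : Fintype T' := hfin.fintype
    have hginj : Function.Injective g := fun s t h => by
      apply Subtype.ext; rw [← hg2 s, ← hg2 t, h]
    have := lag_eval f D hf (Finset.univ.image g) (by
        rw [Finset.card_image_of_injective _ hginj, Finset.card_univ, ← Nat.card_eq_fintype_card, Nat.card_coe_set_eq, Set.ncard, hc]; rfl)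
      c k l (by simp only [Finset.mem_image]; rintro _ ⟨t, _, rfl⟩; exact (hg1 t).1)
      (by
        simp only [Finset.mem_image]; rintro _ ⟨s, _, rfl⟩ _ ⟨t, _, rfl⟩ hne hmem
        have : BB (g s) (k + l) = BB (g t) (k + l) := BB_eq_of_mem hmem
        rw [hg2, hg2] at this
        exact hne (by rw [Subtype.ext this])) e he
      (by simp only [Finset.mem_image]; rintro _ ⟨t, _, rfl⟩; exact (hg1 t).2) y hy
    linarith
  have hfin : T.Finite := Set.finite_of_encard_le_coe hTc
  have hcover : E ⊆ ⋃ t ∈ hfin.toFinset, t := by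
    intro x hx
    simp only [Set.mem_iUnion, Set.Finite.mem_toFinset]
    exact ⟨_, ⟨x, hx, rfl⟩, mem_BB_self _ _⟩
  calc mu E ≤ mu (⋃ t ∈ hfin.toFinset, t) := measure_mono hcover
    _ ≤ ∑ t ∈ hfin.toFinset, mu t := measure_biUnion_finset_le _ _
    _ = ∑ t ∈ hfin.toFinset, mu (BB 0 (k + l)) := by
        apply Finset.sum_congr rfl
        intro t ht
        rw [Set.Finite.mem_toFinset] at ht
        obtain ⟨x, _, rfl⟩ := ht
        exact mu_BB mu _ _
    _ = (hfin.toFinset.card : ENNReal) * mu (BB 0 (k + l)) := by rw [Finset.sum_const, nsmul_eq_mul]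
    _ ≤ D * mu (BB 0 (k + l)) := by
        gcongr
        rw [← Set.ncard_eq_toFinset_card T hfin]
        rw [← hfin.cast_ncard_eq] at hTc
        exact_mod_cast hTc
    _ = _ := by rw [mu_BB_add', mul_assoc]

end Good

lemma coeff_lower (D : ℕ) : ∃ r : ℝ, 0 < r ∧ r ≤ 1 ∧ ∀ f : (K Fq)[X], f.natDegree ≤ D →
    ∀ i, 1 ≤ absK Fq (f.coeff i) → ∃ y ∈ BB (0 : K Fq) 0, r ≤ absK Fq (f.eval y) := by
  have hinf : (BB (0 : K Fq) 0).Infinite := by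
    apply Set.infinite_of_injective_forall_mem (f := fun n : ℕ => (HahnSeries.single (n : ℤ) (1 : Fq) : K Fq))
    · intro a b hab
      have := congrArg HahnSeries.order hab
      simp only [HahnSeries.order_single (one_ne_zero' Fq)] at this
      exact_mod_cast this
    · intro n
      rw [BB_zero]
      intro m hm
      rw [HahnSeries.coeff_single]
      split_ifs with h
      · omega
      · rfl
  obtain ⟨S, hS, hSc⟩ := hinf.exists_subset_card_eq (D + 1)
  set C : ℝ := 1 + ∑ j ∈ S, ∑ i ∈ Finset.range (D + 1), absK Fq ((Lagrange.basis S id j).coeff i) with hC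
  have hC1 : 1 ≤ C := by
    rw [hC]
    have : 0 ≤ ∑ j ∈ S, ∑ i ∈ Finset.range (D + 1), absK Fq ((Lagrange.basis S id j).coeff i) :=
      Finset.sum_nonneg fun _ _ => Finset.sum_nonneg fun _ _ => absK_nonneg _
    linarith
  refine ⟨C⁻¹, by positivity, inv_le_one_of_one_le₀ hC1, ?_⟩
  intro f hf i hi
  by_contra hcon
  push Not at hcon
  have hdeg : f.degree < (S.card : WithBot ℕ) := by
    rw [hSc]; exact lt_of_le_of_lt (Polynomial.degree_le_of_natDegree_le hf) (by exact_mod_cast Nat.lt_succ_self D)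
  have hInterp := Lagrange.eq_interpolate (s := S) (v := id) (Function.injective_id.injOn) hdeg
  have hiD : i ≤ D := by
    by_contra h
    rw [Polynomial.coeff_eq_zero_of_natDegree_lt (by omega), absK_zero] at hi
    linarith
  have : absK Fq (f.coeff i) < 1 := by
    rw [hInterp, Lagrange.interpolate_apply, Polynomial.finsetSum_coeff]
    apply absK_sum_lt _ _ one_pos
    intro j hj
    rw [Polynomial.coeff_C_mul, absK_mul]
    have h1 : absK Fq ((Lagrange.basis S id j).coeff i) < C := by
      have h2 : absK Fq ((Lagrange.basis S id j).coeff i) ≤ ∑ i ∈ Finset.range (D + 1), absK Fq ((Lagrange.basis S id j).coeff i) :=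
        Finset.single_le_sum (f := fun i => absK Fq ((Lagrange.basis S id j).coeff i)) (fun _ _ => absK_nonneg _) (Finset.mem_range.2 (by omega))
      have h3 := Finset.single_le_sum (f := fun j => ∑ i ∈ Finset.range (D + 1), absK Fq ((Lagrange.basis S id j).coeff i)) (fun _ _ => Finset.sum_nonneg fun _ _ => absK_nonneg _) hj
      linarith
    have h4 := hcon j (hS hj)
    calc _ ≤ C⁻¹ * absK Fq ((Lagrange.basis S id j).coeff i) := by gcongr; exact absK_nonneg _; exact h4.le
      _ < C⁻¹ * C := by gcongr
      _ = 1 := inv_mul_cancel₀ (by positivity)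
  linarith

section KM

open MeasureTheory

variable {P : Type} [PartialOrder P]

def Compat (F : Finset P) (s : P) : Prop := s ∉ F ∧ ∀ f ∈ F, s ≤ f ∨ f ≤ s

def Marked (psi : P → K Fq → ℝ) (e r : ℝ) (F : Finset P) (x : K Fq) : Prop :=
  ∃ F' : Finset P, F ⊆ F' ∧ IsChain (· ≤ ·) (F' : Set P) ∧
    (∀ s ∈ F', s ∉ F → e ≤ psi s x ∧ psi s x < r) ∧ ∀ s, Compat F' s → r ≤ psi s x

def kmC (Fq : Type) [Fintype Fq] : ℕ → ENNReal
  | 0 => 0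
  | m + 1 => (kmC Fq m + 1) * (Fintype.card Fq : ENNReal)

lemma kmC_ne_top (m : ℕ) : kmC Fq m ≠ ⊤ := by
  induction m with
  | zero => simp [kmC]
  | succ m ih =>
    rw [kmC]
    exact ENNReal.mul_ne_top (ENNReal.add_ne_top.2 ⟨ih, ENNReal.one_ne_top⟩) (ENNReal.natCast_ne_top _)

lemma chain_insert {F : Finset P} (hF : IsChain (· ≤ ·) (F : Set P)) {s : P} (hs : Compat F s) :
    IsChain (· ≤ ·) ((insert s F : Finset P) : Set P) := by
  rw [Finset.coe_insert]
  exact hF.insert (fun f hf _ => hs.2 f hf)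

variable [MeasurableSpace (K Fq)] [BorelSpace (K Fq)] (mu : Measure (K Fq)) [mu.IsAddHaarMeasure]

lemma km (psi : P → K Fq → ℝ) (e r : ℝ) (d : ENNReal) (L : ℕ)
    (hlen : ∀ F : Finset P, IsChain (· ≤ ·) (F : Set P) → F.card ≤ L)
    (hgood : ∀ s c k, (∃ y ∈ BB c k, r ≤ psi s y) →
      mu {x | x ∈ BB c k ∧ psi s x < e} ≤ d * mu (BB 0 k))
    (hcont : ∀ s x, psi s x < r → ∃ j : ℕ, ∀ y ∈ BB x j, psi s y < r) (m : ℕ) :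
    ∀ F : Finset P, IsChain (· ≤ ·) (F : Set P) → L ≤ F.card + m → ∀ (c : K Fq) (k : ℤ),
      (∀ s, Compat F s → ∃ y ∈ BB c k, r ≤ psi s y) →
      mu {x | x ∈ BB c k ∧ ¬ Marked psi e r F x} ≤ kmC Fq m * d * mu (BB 0 k) := by
  induction m with
  | zero =>
    intro F hF hL c k _
    have : {x | x ∈ BB c k ∧ ¬ Marked psi e r F x} = ∅ := by
      ext x
      simp only [Set.mem_setOf_eq, Set.mem_empty_iff_false, iff_false, not_and, not_not]
      intro _
      refine ⟨F, subset_rfl, hF, fun s h1 h2 => absurd h1 h2, fun s hs => ?_⟩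
      have := hlen _ (chain_insert hF hs)
      rw [Finset.card_insert_of_notMem hs.1] at this
      omega
    rw [this]; simp
  | succ m ih =>
    intro F hF hL c k hsup
    set E := {x | x ∈ BB c k ∧ ¬ Marked psi e r F x} with hE
    rw [← mu_BB mu c k]
    apply covering mu E c k (fun x hx => hx.1)
    intro x hx
    have hex : ∃ j : ℕ, ∃ s, Compat F s ∧ ∀ y ∈ BB x (k + j), psi s y < r := by
      have : ∃ s, Compat F s ∧ psi s x < r := by
        by_contra hcon
        push Not at hcon
        exact hx.2 ⟨F, subset_rfl, hF, fun s h1 h2 => absurd h1 h2, hcon⟩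
      obtain ⟨s, hs, hsx⟩ := this
      obtain ⟨j, hj⟩ := hcont s x hsx
      refine ⟨(j - k).toNat, s, hs, fun y hy => hj y (BB_mono x (by omega) hy)⟩
    obtain ⟨s, hs, hsj⟩ := Nat.find_spec hex
    have hmin := fun i (hi : i < Nat.find hex) => Nat.find_min hex hi
    set j := Nat.find hex with hjdef
    have hj0 : j ≠ 0 := by
      intro h0
      obtain ⟨y, hy, hyr⟩ := hsup s hs
      have : y ∈ BB x (k + j) := by
        rw [h0]; simpa [BB_eq_of_mem hx.1] using hy
      linarith [hsj y this]
    obtain ⟨i, hi⟩ := Nat.exists_eq_succ_of_ne_zero hj0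
    have hpar : ∀ s, Compat F s → ∃ y ∈ BB x (k + i), r ≤ psi s y := by
      intro s' hs'
      by_contra hcon
      push Not at hcon
      exact hmin i (by omega) ⟨s', hs', hcon⟩
    have h1 := ih (insert s F) (chain_insert hF hs) (by
      rw [Finset.card_insert_of_notMem hs.1]; omega) x (k + i) (by
        intro s' hs'
        refine hpar s' ⟨fun h => hs'.1 (Finset.mem_insert_of_mem h), fun f hf => hs'.2 f (Finset.mem_insert_of_mem hf)⟩)
    have h2 := hgood s x (k + i) (hpar s hs)
    refine ⟨j, ?_⟩
    have hsub : E ∩ BB x (k + j) ⊆ {y | y ∈ BB x (k + i) ∧ ¬ Marked psi e r (insert s F) y} ∪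
        {y | y ∈ BB x (k + i) ∧ psi s y < e} := by
      rintro y ⟨hyE, hyB⟩
      have hyi : y ∈ BB x (k + i) := BB_mono x (by omega) hyB
      by_cases hps : psi s y < e
      · exact Or.inr ⟨hyi, hps⟩
      · left
        refine ⟨hyi, ?_⟩
        rintro ⟨F', hFF', hch, hin, hco⟩
        apply hyE.2
        refine ⟨F', (Finset.subset_insert _ _).trans hFF', hch, ?_, hco⟩
        intro t ht htF
        by_cases hts : t = s
        · subst hts
          exact ⟨not_lt.1 hps, hsj y hyB⟩
        · exact hin t ht (by simp [hts, htF])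
    calc mu (E ∩ BB x (k + j)) ≤ _ := measure_mono hsub
      _ ≤ _ := measure_union_le _ _
      _ ≤ kmC Fq m * d * mu (BB 0 (k + i)) + d * mu (BB 0 (k + i)) := add_le_add h1 h2
      _ = kmC Fq (m + 1) * d * mu (BB x (k + j)) := by
        rw [mu_BB mu x, mu_BB_succ mu (k + i), hi, kmC]
        push_cast
        rw [add_assoc]
        ring

end KM

lemma emb_monomial (i : ℕ) (a : Fq) : emb Fq (monomial i a) = HahnSeries.single (-(i : ℤ)) a := by
  have h1 : ∀ i : ℕ, Tvar Fq ^ i = HahnSeries.single (-(i : ℤ)) 1 := by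
    intro i
    rw [Tvar, HahnSeries.single_pow]; simp
  simp only [emb, Polynomial.coe_eval₂RingHom, Polynomial.eval₂_monomial, h1]
  have h2 : algebraMap Fq (K Fq) a = HahnSeries.C a := by
    rw [HahnSeries.algebraMap_apply']
    simp
  rw [h2, HahnSeries.C_apply, HahnSeries.single_mul_single]
  simp

lemma coeff_emb (p : Fq[X]) (m : ℤ) :
    (emb Fq p).coeff m = if m ≤ 0 then p.coeff (-m).toNat else 0 := by
  induction p using Polynomial.induction_on' with
  | add p q hp hq => rw [map_add, HahnSeries.coeff_add, hp, hq]; split_ifs <;> simp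
  | monomial i a =>
    rw [emb_monomial, HahnSeries.coeff_single, Polynomial.coeff_monomial]
    by_cases h : m = -(i : ℤ)
    · subst h; simp
    · rw [if_neg h]
      split_ifs with h1 h2
      · exfalso; omega
      · rfl
      · rfl

lemma absK_emb {p : Fq[X]} (hp : p ≠ 0) : absK Fq (emb Fq p) = qq Fq ^ p.natDegree := by
  apply le_antisymm
  · have : emb Fq p ∈ UU (-(p.natDegree : ℤ)) := by
      intro m hm
      rw [coeff_emb, if_pos (by omega), Polynomial.coeff_eq_zero_of_natDegree_lt (by omega)]
    rw [mem_UU_iff] at this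
    simpa using this
  · have : emb Fq p ∉ UU (-(p.natDegree : ℤ) + 1) := by
      intro h
      have := h (-(p.natDegree : ℤ)) (by omega)
      rw [coeff_emb, if_pos (by omega)] at this
      simp at this
      exact hp this
    rw [mem_UU_succ_iff, not_lt] at this
    simpa using this

lemma one_le_absK_emb {p : Fq[X]} (hp : p ≠ 0) : 1 ≤ absK Fq (emb Fq p) := by
  rw [absK_emb hp]; exact one_le_pow₀ one_lt_qq.le

lemma emb_injective : Function.Injective (emb Fq) := by
  rw [injective_iff_map_eq_zero]
  intro p hp
  by_contra h
  have := one_le_absK_emb h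
  rw [hp, absK_zero] at this
  linarith

lemma absK_emb_lt_iff {p : Fq[X]} {m : ℕ} : absK Fq (emb Fq p) < qq Fq ^ m ↔ p.degree < m := by
  by_cases hp : p = 0
  · subst hp; simp [absK_zero, pow_pos qq_pos]
  · rw [absK_emb hp, pow_lt_pow_iff_right₀ one_lt_qq, Polynomial.degree_eq_natDegree hp]
    exact Nat.cast_lt.symm

lemma absK_Tvar : absK Fq (Tvar Fq) = qq Fq := by
  have := absK_emb (Fq := Fq) (p := X) X_ne_zero
  simpa [emb] using this

lemma Tvar_ne_zero : Tvar Fq ≠ 0 := by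
  intro h; have := absK_Tvar (Fq := Fq); rw [h, absK_zero] at this; linarith [qq_pos (Fq := Fq)]

section Minors

open Matrix

variable {n : ℕ}

/-- maximal absolute value of the maximal minors -/
def mx {j : ℕ} (B : Matrix (Fin j) (Fin (n + 1)) (K Fq)) : ℝ :=
  ⨆ I : Fin j → Fin (n + 1), absK Fq (B.submatrix id I).det

lemma le_mx {j : ℕ} (B : Matrix (Fin j) (Fin (n + 1)) (K Fq)) (I : Fin j → Fin (n + 1)) :
    absK Fq (B.submatrix id I).det ≤ mx B :=
  le_ciSup (f := fun I : Fin j → Fin (n + 1) => absK Fq (B.submatrix id I).det) (Set.finite_range _).bddAbove I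

lemma exists_mx {j : ℕ} (B : Matrix (Fin j) (Fin (n + 1)) (K Fq)) :
    ∃ I : Fin j → Fin (n + 1), absK Fq (B.submatrix id I).det = mx B :=
  exists_eq_ciSup_of_finite

lemma mx_nonneg {j : ℕ} (B : Matrix (Fin j) (Fin (n + 1)) (K Fq)) : 0 ≤ mx B :=
  (absK_nonneg _).trans (le_mx B (fun _ => 0))

lemma mx_mul {j : ℕ} (A : Matrix (Fin j) (Fin j) (K Fq)) (B : Matrix (Fin j) (Fin (n + 1)) (K Fq)) :
    mx (A * B) = absK Fq A.det * mx B := by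
  have h : ∀ I, absK Fq ((A * B).submatrix id I).det = absK Fq A.det * absK Fq (B.submatrix id I).det := by
    intro I
    rw [← absK_mul, ← det_mul]
    rfl
  apply le_antisymm
  · obtain ⟨I, hI⟩ := exists_mx (A * B)
    rw [← hI, h]
    exact mul_le_mul_of_nonneg_left (le_mx B I) (absK_nonneg _)
  · obtain ⟨I, hI⟩ := exists_mx B
    rw [← hI, ← h]
    exact le_mx _ I

lemma mx_zero (B : Matrix (Fin 0) (Fin (n + 1)) (K Fq)) : mx B = 1 := by
  obtain ⟨I, hI⟩ := exists_mx B
  rw [← hI, det_isEmpty, absK_one]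

lemma mx_cons {j : ℕ} (B : Matrix (Fin j) (Fin (n + 1)) (K Fq)) (B' : Matrix (Fin (j + 1)) (Fin (n + 1)) (K Fq))
    (hB : ∀ i k, B' (Fin.succ i) k = B i k) (s : ℝ) (hs : ∀ k, absK Fq (B' 0 k) ≤ s) :
    mx B' ≤ s * mx B := by
  have hs0 : 0 ≤ s := (absK_nonneg _).trans (hs 0)
  obtain ⟨I, hI⟩ := exists_mx B'
  rw [← hI, det_succ_row_zero]
  apply absK_sum_le _ _ (mul_nonneg hs0 (mx_nonneg B))
  intro k _
  rw [absK_mul, absK_mul, absK_pow, absK_neg, absK_one, one_pow, one_mul]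
  apply mul_le_mul (hs _) _ (absK_nonneg _) hs0
  have : (B'.submatrix id I).submatrix Fin.succ k.succAbove = B.submatrix id (I ∘ k.succAbove) := by
    ext a b; simp [hB]
  rw [this]
  exact le_mx _ _

lemma exists_minor_ne_zero {j : ℕ} (B : Matrix (Fin j) (Fin (n + 1)) (K Fq)) (hB : LinearIndependent (K Fq) B.row) :
    ∃ I : Fin j → Fin (n + 1), (B.submatrix id I).det ≠ 0 := by
  have hr := hB.rank_matrix
  rw [rank_eq_finrank_span_cols, Fintype.card_fin] at hr
  obtain ⟨f, hf1, _, hf3⟩ := Submodule.exists_fun_fin_finrank_span_eq (K Fq) (Set.range B.col)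
  choose I0 hI0 using hf1
  refine ⟨fun i => I0 (Fin.cast hr.symm i), ?_⟩
  have : LinearIndependent (K Fq) (B.submatrix id (fun i => I0 (Fin.cast hr.symm i))).col := by
    have h2 := hf3.comp (Fin.cast hr.symm) (Fin.cast_injective _)
    have heq : (B.submatrix id (fun i => I0 (Fin.cast hr.symm i))).col = f ∘ Fin.cast hr.symm :=
      funext fun i => hI0 _
    rw [heq]; exact h2
  rw [linearIndependent_cols_iff_isUnit, isUnit_iff_isUnit_det] at this
  exact this.ne_zero

/-- the embedded vector -/
def ev (v : Fin (n + 1) → Fq[X]) : Fin (n + 1) → K Fq := fun i => emb Fq (v i)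

def EM {j : ℕ} (v : Fin j → Fin (n + 1) → Fq[X]) : Matrix (Fin j) (Fin (n + 1)) (K Fq) :=
  Matrix.of fun i => ev (v i)

lemma mx_EM_pow {j : ℕ} (v : Fin j → Fin (n + 1) → Fq[X]) (hv : LinearIndependent (K Fq) (fun i => ev (v i))) :
    ∃ d : ℕ, mx (EM v) = qq Fq ^ d := by
  obtain ⟨I0, hI0⟩ := exists_minor_ne_zero (EM v) hv
  obtain ⟨I, hI⟩ := exists_mx (EM v)
  have hpos : 0 < absK Fq ((EM v).submatrix id I).det := by
    rw [hI]; exact lt_of_lt_of_le (absK_pos hI0) (le_mx _ _)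
  rw [← hI]
  have h1 : ((EM v).submatrix id I).det = emb Fq ((Matrix.of fun i k => v i (I k)).det) := by
    rw [RingHom.map_det]; rfl
  rw [h1] at hpos ⊢
  refine ⟨_, absK_emb ?_⟩
  intro h
  rw [h, map_zero, absK_zero] at hpos
  exact lt_irrefl _ hpos

def IsBas {j : ℕ} (v : Fin j → Fin (n + 1) → Fq[X]) (W : Submodule (K Fq) (Fin (n + 1) → K Fq)) : Prop :=
  LinearIndependent (K Fq) (fun i => ev (v i)) ∧ Submodule.span (K Fq) (Set.range fun i => ev (v i)) = W

lemma IsBas.card {j : ℕ} {v : Fin j → Fin (n + 1) → Fq[X]} {W : Submodule (K Fq) (Fin (n + 1) → K Fq)}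
    (h : IsBas v W) : Module.finrank (K Fq) W = j := by
  rw [← h.2, finrank_span_eq_card h.1, Fintype.card_fin]

/-- rational subspaces -/
abbrev RS (Fq : Type) [Field Fq] [Fintype Fq] (n : ℕ) : Type :=
  {W : Submodule (K Fq) (Fin (n + 1) → K Fq) // ∃ (j : ℕ) (v : Fin j → Fin (n + 1) → Fq[X]), IsBas v W}

lemma RS_le {V W : RS Fq n} : V ≤ W ↔ V.1 ≤ W.1 := Iff.rfl

lemma RS_chain (F : Finset (RS Fq n)) (hF : IsChain (· ≤ ·) (F : Set (RS Fq n))) : F.card ≤ n + 2 := by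
  have : Set.InjOn (fun W : RS Fq n => Module.finrank (K Fq) W.1) F := by
    intro V hV W hW h
    rcases hF.total hV hW with h1 | h1
    · exact Subtype.ext (Submodule.eq_of_le_of_finrank_eq h1 h)
    · exact (Subtype.ext (Submodule.eq_of_le_of_finrank_eq h1 h.symm)).symm
  rw [← Finset.card_image_of_injOn this]
  calc _ ≤ (Finset.range (n + 2)).card := by
        apply Finset.card_le_card
        intro d hd
        rw [Finset.mem_image] at hd
        obtain ⟨W, _, rfl⟩ := hd
        rw [Finset.mem_range]
        have := Submodule.finrank_le W.1
        simp at this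
        omega
    _ = n + 2 := Finset.card_range _

lemma exists_min_bas (W : RS Fq n) : ∃ (j : ℕ) (v : Fin j → Fin (n + 1) → Fq[X]), IsBas v W.1 ∧
    ∀ (j' : ℕ) (v' : Fin j' → Fin (n + 1) → Fq[X]), IsBas v' W.1 → mx (EM v) ≤ mx (EM v') := by
  have hex : ∃ d : ℕ, ∃ (j : ℕ) (v : Fin j → Fin (n + 1) → Fq[X]), IsBas v W.1 ∧ mx (EM v) = qq Fq ^ d := by
    obtain ⟨j, v, hv⟩ := W.2
    obtain ⟨d, hd⟩ := mx_EM_pow v hv.1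
    exact ⟨d, j, v, hv, hd⟩
  obtain ⟨j, v, hv, hd⟩ := Nat.find_spec hex
  refine ⟨j, v, hv, fun j' v' hv' => ?_⟩
  obtain ⟨d', hd'⟩ := mx_EM_pow v' hv'.1
  rw [hd, hd']
  exact pow_le_pow_right₀ one_lt_qq.le (Nat.find_min' hex ⟨j', v', hv', hd'⟩)

def rk (W : RS Fq n) : ℕ := (exists_min_bas W).choose
def bas (W : RS Fq n) : Fin (rk W) → Fin (n + 1) → Fq[X] := (exists_min_bas W).choose_spec.choose
lemma bas_spec (W : RS Fq n) : IsBas (bas W) W.1 ∧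
    ∀ (j' : ℕ) (v' : Fin j' → Fin (n + 1) → Fq[X]), IsBas v' W.1 → mx (EM (bas W)) ≤ mx (EM v') :=
  (exists_min_bas W).choose_spec.choose_spec

lemma rk_le (W : RS Fq n) : rk W ≤ n + 1 := by
  rw [← (bas_spec W).1.card]
  have := Submodule.finrank_le W.1
  simpa using this

lemma bas_min (W : RS Fq n) {j : ℕ} (v : Fin j → Fin (n + 1) → Fq[X]) (hv : IsBas v W.1)
    (G : Matrix (Fin (n + 1)) (Fin (n + 1)) (K Fq)) : mx (EM (bas W) * G) ≤ mx (EM v * G) := by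
  obtain ⟨hb, hmin⟩ := bas_spec W
  have hj : rk W = j := by rw [← hb.card, hv.card]
  generalize bas W = b at hb hmin
  generalize rk W = j' at b hb hmin hj
  subst hj
  have hC : ∀ i, ∃ c : Fin j' → K Fq, ∑ k, c k • ev (b k) = ev (v i) := by
    intro i
    rw [← Submodule.mem_span_range_iff_exists_fun, hb.2, ← hv.2]
    exact Submodule.subset_span ⟨i, rfl⟩
  choose c hc using hC
  have hE : EM v = Matrix.of c * EM b := by
    ext i k
    rw [Matrix.mul_apply]
    have := congrFun (hc i) k
    simp only [Finset.sum_apply, Pi.smul_apply, smul_eq_mul] at this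
    simp [EM, this]
  have h1 := hmin _ v hv
  rw [hE, mx_mul] at h1
  have hpos : 0 < mx (EM b) := by
    obtain ⟨d, hd⟩ := mx_EM_pow b hb.1
    rw [hd]; exact pow_pos qq_pos _
  have h2 : 1 ≤ absK Fq (Matrix.of c).det := by
    by_contra h
    push Not at h
    nlinarith
  rw [hE, Matrix.mul_assoc, mx_mul]
  nlinarith [mx_nonneg (EM b * G)]

end Minors

section Nondiv

open Matrix MeasureTheory

variable {n : ℕ}

def GP (n : ℕ) (a b : K Fq) : Matrix (Fin (n + 1)) (Fin (n + 1)) (K Fq)[X] :=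
  Matrix.of fun m k => if k = 0 then C a * X ^ (m : ℕ) else if m = k then C b else 0

def GM (n : ℕ) (a b x : K Fq) : Matrix (Fin (n + 1)) (Fin (n + 1)) (K Fq) :=
  Matrix.of fun m k => if k = 0 then a * x ^ (m : ℕ) else if m = k then b else 0

def psi (a b : K Fq) (W : RS Fq n) (x : K Fq) : ℝ := mx (EM (bas W) * GM n a b x)

def pmin {j : ℕ} (E : Matrix (Fin j) (Fin (n + 1)) (K Fq)) (a b : K Fq) (I : Fin j → Fin (n + 1)) : (K Fq)[X] :=
  ((E.map C * GP n a b).submatrix id I).det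

lemma eval_pmin {j : ℕ} (E : Matrix (Fin j) (Fin (n + 1)) (K Fq)) (a b : K Fq) (I : Fin j → Fin (n + 1)) (x : K Fq) :
    (pmin E a b I).eval x = ((E * GM n a b x).submatrix id I).det := by
  rw [pmin, ← Polynomial.coe_evalRingHom, RingHom.map_det]
  congr 1
  ext1 i k
  simp only [RingHom.mapMatrix_apply, Matrix.map_apply, Matrix.submatrix_apply, Matrix.mul_apply, GP, GM,
    Matrix.of_apply, Polynomial.coe_evalRingHom, Polynomial.eval_finsetSum, Polynomial.eval_mul, Polynomial.eval_C]
  apply Finset.sum_congr rfl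
  intro m _
  split_ifs <;> simp

lemma natDegree_det_le' {j : ℕ} (M : Matrix (Fin j) (Fin j) (K Fq)[X]) (d : ℕ) (h : ∀ i k, (M i k).natDegree ≤ d) :
    M.det.natDegree ≤ j * d := by
  rw [Matrix.det_apply']
  apply Polynomial.natDegree_sum_le_of_forall_le
  intro s _
  refine (Polynomial.natDegree_mul_le).trans ?_
  have h1 : (((Equiv.Perm.sign s : ℤˣ) : ℤ) : (K Fq)[X]).natDegree = 0 := Polynomial.natDegree_intCast _
  rw [h1, zero_add]
  refine (Polynomial.natDegree_prod_le _ _).trans ?_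
  calc _ ≤ ∑ i : Fin j, d := Finset.sum_le_sum fun i _ => h _ _
    _ = j * d := by simp

lemma natDegree_pmin {j : ℕ} (hj : j ≤ n + 1) (E : Matrix (Fin j) (Fin (n + 1)) (K Fq)) (a b : K Fq) (I : Fin j → Fin (n + 1)) :
    (pmin E a b I).natDegree ≤ (n + 1) * n := by
  refine (natDegree_det_le' _ n ?_).trans (Nat.mul_le_mul_right _ hj)
  intro i k
  rw [Matrix.submatrix_apply, Matrix.mul_apply]
  apply Polynomial.natDegree_sum_le_of_forall_le
  intro m _
  rw [Matrix.map_apply]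
  refine (Polynomial.natDegree_C_mul_le _ _).trans ?_
  simp only [GP, Matrix.of_apply]
  split_ifs
  · refine (Polynomial.natDegree_C_mul_le _ _).trans ?_
    rw [Polynomial.natDegree_X_pow]; omega
  · simp
  · simp

lemma GM_mul {j : ℕ} (E : Matrix (Fin j) (Fin (n + 1)) (K Fq)) (a b x : K Fq) (i : Fin j) (k : Fin (n + 1)) :
    (E * GM n a b x) i k = if k = 0 then a * ∑ m, E i m * x ^ (m : ℕ) else b * E i k := by
  rw [Matrix.mul_apply]
  split_ifs with h
  · rw [Finset.mul_sum]
    apply Finset.sum_congr rfl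
    intro m _
    simp only [GM, Matrix.of_apply, if_pos h]; ring
  · simp only [GM, Matrix.of_apply, if_neg h]
    simp [mul_comm]

lemma GP_mul {j : ℕ} (E : Matrix (Fin j) (Fin (n + 1)) (K Fq)) (a b : K Fq) (i : Fin j) (k : Fin (n + 1)) :
    (E.map C * GP n a b) i k = if k = 0 then C a * ∑ m, C (E i m) * X ^ (m : ℕ) else C (b * E i k) := by
  rw [Matrix.mul_apply]
  split_ifs with h
  · rw [Finset.mul_sum]
    apply Finset.sum_congr rfl
    intro m _
    simp only [GP, Matrix.of_apply, if_pos h, Matrix.map_apply]; ring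
  · simp only [GP, Matrix.of_apply, if_neg h, Matrix.map_apply]
    simp [mul_comm]

/-- some maximal minor polynomial has a big coefficient -/
lemma big_coeff {j : ℕ} (hj : j ≤ n) (v : Fin (j + 1) → Fin (n + 1) → Fq[X])
    (hv : LinearIndependent (K Fq) (fun i => ev (v i))) (a b : K Fq)
    (hb : absK Fq b ≤ 1) (hab : 1 ≤ absK Fq a * absK Fq b ^ n) :
    ∃ J i, 1 ≤ absK Fq ((pmin (EM v) a b J).coeff i) := by
  obtain ⟨I, hI⟩ := exists_minor_ne_zero (EM v) hv
  have hIinj : Function.Injective I := by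
    intro s t hst
    by_contra hne
    exact hI (Matrix.det_zero_of_column_eq hne (fun k => by simp [hst]))
  have hi0 : ∃ i0, ∀ i, i ≠ i0 → I i ≠ 0 := by
    by_cases h : ∃ i, I i = 0
    · obtain ⟨i, hi⟩ := h
      exact ⟨i, fun k hk h0 => hk (hIinj (h0.trans hi.symm))⟩
    · push Not at h
      exact ⟨0, fun i _ => h i⟩
  obtain ⟨i0, hi0⟩ := hi0
  set E := EM v with hE
  refine ⟨Function.update I i0 0, (I i0 : ℕ), ?_⟩
  set A0 : Matrix (Fin (j + 1)) (Fin (j + 1)) (K Fq) := Matrix.of fun i k => b * E i (I k) with hA0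
  have h1 : (E.map C * GP n a b).submatrix id (Function.update I i0 0) =
      (A0.map C).updateCol i0 (∑ m : Fin (n + 1), (C a * X ^ (m : ℕ) : (K Fq)[X]) • (fun i => C (E i m))) := by
    ext1 i k
    rw [Matrix.submatrix_apply, GP_mul]
    by_cases hk : k = i0
    · subst hk
      simp only [Function.update_self, if_true, Matrix.updateCol_self, Finset.sum_apply, Pi.smul_apply, smul_eq_mul, id]
      rw [Finset.mul_sum]
      apply Finset.sum_congr rfl
      intro m _
      ring
    · rw [Function.update_of_ne hk, if_neg (hi0 k hk), Matrix.updateCol_ne hk]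
      rfl
  have h2 : pmin E a b (Function.update I i0 0) =
      ∑ m : Fin (n + 1), C (a * (A0.updateCol i0 (fun i => E i m)).det) * X ^ (m : ℕ) := by
    rw [pmin, h1, ← Matrix.cramer_apply, map_sum, Finset.sum_apply]
    apply Finset.sum_congr rfl
    intro m _
    rw [map_smul, Pi.smul_apply, Matrix.cramer_apply, smul_eq_mul, C_mul]
    have : (A0.map C).updateCol i0 (fun i => C (E i m)) = (C : K Fq →+* (K Fq)[X]).mapMatrix (A0.updateCol i0 (fun i => E i m)) := by
      ext1 i k
      simp only [RingHom.mapMatrix_apply, Matrix.map_apply, Matrix.updateCol_apply]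
      split_ifs <;> rfl
    rw [this, ← RingHom.map_det]
    ring
  have h3 : (pmin E a b (Function.update I i0 0)).coeff (I i0 : ℕ) = a * (A0.updateCol i0 (fun i => E i (I i0))).det := by
    rw [h2, Polynomial.finsetSum_coeff]
    simp only [Polynomial.coeff_C_mul, Polynomial.coeff_X_pow]
    rw [Finset.sum_eq_single (I i0)]
    · simp
    · intro m _ hm
      rw [if_neg, mul_zero]
      intro h; exact hm (Fin.ext h.symm)
    · simp
  have h4 : A0.updateCol i0 (fun i => E i (I i0)) =
      Matrix.of fun i k => (if k = i0 then 1 else b) * (E.submatrix id I) i k := by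
    ext1 i k
    rw [Matrix.updateCol_apply]
    by_cases hk : k = i0
    · subst hk; simp
    · simp [hk, hA0]
  rw [h3, h4, Matrix.det_mul_row, absK_mul, absK_mul, absK_prod]
  have h5 : absK Fq b ^ n ≤ ∏ k : Fin (j + 1), absK Fq (if k = i0 then 1 else b) := by
    rw [← Finset.mul_prod_erase _ _ (Finset.mem_univ i0), if_pos rfl, absK_one, one_mul,
      Finset.prod_congr rfl (g := fun _ => absK Fq b) (by
        intro k hk; rw [if_neg (Finset.ne_of_mem_erase hk)]), Finset.prod_const, Finset.card_erase_of_mem (Finset.mem_univ _)]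
    simp only [Finset.card_univ, Fintype.card_fin, Nat.add_sub_cancel]
    exact pow_le_pow_of_le_one (absK_nonneg _) hb hj
  have h6 : 1 ≤ absK Fq (E.submatrix id I).det := by
    have : (E.submatrix id I).det = emb Fq ((Matrix.of fun i k => v i (I k)).det) := by
      rw [RingHom.map_det]; rfl
    rw [this] at hI ⊢
    apply one_le_absK_emb
    intro h; rw [h, map_zero] at hI; exact hI rfl
  calc (1:ℝ) ≤ absK Fq a * absK Fq b ^ n := hab
    _ ≤ absK Fq a * ∏ k : Fin (j + 1), absK Fq (if k = i0 then 1 else b) := mul_le_mul_of_nonneg_left h5 (absK_nonneg _)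
    _ = absK Fq a * ((∏ k : Fin (j + 1), absK Fq (if k = i0 then 1 else b)) * 1) := by rw [mul_one]
    _ ≤ _ := by
        apply mul_le_mul_of_nonneg_left _ (absK_nonneg _)
        apply mul_le_mul_of_nonneg_left h6
        exact Finset.prod_nonneg fun _ _ => absK_nonneg _

lemma psi_sup (r : ℝ) (hr1 : r ≤ 1) (hr : ∀ f : (K Fq)[X], f.natDegree ≤ (n + 1) * n →
    ∀ i, 1 ≤ absK Fq (f.coeff i) → ∃ y ∈ BB (0 : K Fq) 0, r ≤ absK Fq (f.eval y)) (a b : K Fq)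
    (hb : absK Fq b ≤ 1) (hab : 1 ≤ absK Fq a * absK Fq b ^ n) (W : RS Fq n) :
    ∃ y ∈ BB (0 : K Fq) 0, r ≤ psi a b W y := by
  have hle := rk_le W
  have hb2 := (bas_spec W).1
  unfold psi
  generalize bas W = v at hb2
  generalize rk W = j at v hb2 hle
  cases j with
  | zero => exact ⟨0, mem_BB_self _ _, by rw [mx_zero]; exact hr1⟩
  | succ j =>
    obtain ⟨J, i, h⟩ := big_coeff (by omega) v hb2.1 a b hb hab
    obtain ⟨y, hy, h1⟩ := hr _ (natDegree_pmin hle _ _ _ _) i h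
    refine ⟨y, hy, h1.trans ?_⟩
    rw [eval_pmin]
    exact le_mx _ _

lemma psi_cont (a b : K Fq) (r : ℝ) (W : RS Fq n) (x : K Fq) (h : psi a b W x < r) :
    ∃ j : ℕ, ∀ y ∈ BB x j, psi a b W y < r := by
  have hopen : IsOpen {y | psi a b W y < r} := by
    have : {y | psi a b W y < r} = ⋂ I : Fin (rk W) → Fin (n + 1), {y | absK Fq ((pmin (EM (bas W)) a b I).eval y) < r} := by
      ext y
      simp only [Set.mem_setOf_eq, Set.mem_iInter]
      constructor
      · intro h I; rw [eval_pmin]; exact (le_mx _ _).trans_lt h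
      · intro h
        obtain ⟨I, hI⟩ := exists_mx (EM (bas W) * GM n a b y)
        unfold psi
        rw [← hI, ← eval_pmin]; exact h I
    rw [this]
    apply isOpen_iInter_of_finite
    intro I
    exact isOpen_lt (continuous_absK.comp (Polynomial.continuous _)) continuous_const
  obtain ⟨j, hj⟩ := mem_nhds_iff_BB.1 (hopen.mem_nhds h)
  exact ⟨j, fun y hy => hj hy⟩

variable [MeasurableSpace (K Fq)] [BorelSpace (K Fq)] (mu : Measure (K Fq)) [mu.IsAddHaarMeasure]

lemma psi_good (a b : K Fq) (l : ℕ) (e r : ℝ) (he : 0 < e) (hr : e * qq Fq ^ (l * ((n + 1) * n)) ≤ r)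
    (W : RS Fq n) (c : K Fq) (k : ℤ) (h : ∃ y ∈ BB c k, r ≤ psi a b W y) :
    mu {x | x ∈ BB c k ∧ psi a b W x < e} ≤
      (((n + 1) * n : ℕ) : ENNReal) * ((Fintype.card Fq : ENNReal) ^ l)⁻¹ * mu (BB 0 k) := by
  obtain ⟨y, hy, hry⟩ := h
  obtain ⟨I, hI⟩ := exists_mx (EM (bas W) * GM n a b y)
  refine (measure_mono ?_).trans (good_poly mu (pmin (EM (bas W)) a b I) _ (natDegree_pmin (rk_le W) _ _ _ _) c k l e r he hr y hy ?_)
  · rintro x ⟨hx, hxe⟩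
    refine ⟨hx, ?_⟩
    rw [eval_pmin]
    exact (le_mx _ _).trans_lt hxe
  · rw [eval_pmin, hI]; exact hry

end Nondiv

section Nondiv2

open Matrix MeasureTheory

variable {n : ℕ}

def botRS (Fq : Type) [Field Fq] [Fintype Fq] (n : ℕ) : RS Fq n :=
  ⟨⊥, 0, Fin.elim0, by
    refine ⟨linearIndependent_empty_type, ?_⟩
    rw [Set.range_eq_empty, Submodule.span_empty]⟩

lemma psi_bot (a b x : K Fq) : psi a b (botRS Fq n) x = 1 := by
  have h := (bas_spec (botRS Fq n)).1.card
  have h0 : rk (botRS Fq n) = 0 := by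
    rw [← h]; exact finrank_bot _ _
  unfold psi
  generalize bas (botRS Fq n) = v
  generalize rk (botRS Fq n) = j at v h0
  subst h0
  exact mx_zero _

lemma IsBas_cons (V : RS Fq n) (v : Fin (n + 1) → Fq[X]) (hv : ev v ∉ V.1) :
    IsBas (Fin.cons v (bas V) : Fin (rk V + 1) → Fin (n + 1) → Fq[X]) (Submodule.span (K Fq) {ev v} ⊔ V.1) := by
  obtain ⟨hb1, hb2⟩ := (bas_spec V).1
  have hcons : (fun i => ev ((Fin.cons v (bas V) : Fin (rk V + 1) → Fin (n + 1) → Fq[X]) i)) =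
      Fin.cons (ev v) (fun i => ev (bas V i)) := by
    funext i
    refine Fin.cases ?_ (fun i => ?_) i <;> simp
  constructor
  · rw [hcons]
    rw [linearIndependent_finCons]
    exact ⟨hb1, by rw [hb2]; exact hv⟩
  · rw [hcons, Fin.range_cons, Submodule.span_insert, hb2]

def addRS (V : RS Fq n) (v : Fin (n + 1) → Fq[X]) (hv : ev v ∉ V.1) : RS Fq n :=
  ⟨_, _, _, IsBas_cons V v hv⟩

lemma psi_add (a b x : K Fq) (V : RS Fq n) (v : Fin (n + 1) → Fq[X]) (hv : ev v ∉ V.1) (s : ℝ)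
    (hs0 : absK Fq (a * ∑ m, emb Fq (v m) * x ^ (m : ℕ)) ≤ s)
    (hs : ∀ k, k ≠ 0 → absK Fq (b * emb Fq (v k)) ≤ s) :
    psi a b (addRS V v hv) x ≤ s * psi a b V x := by
  refine (bas_min (addRS V v hv) _ (IsBas_cons V v hv) (GM n a b x)).trans ?_
  apply mx_cons
  · intro i k
    rw [Matrix.mul_apply, Matrix.mul_apply]
    rfl
  · intro k
    rw [GM_mul]
    split_ifs with h
    · exact hs0
    · exact hs k h

lemma marked_noshort (a b x : K Fq) (e r : ℝ) (her : e ≤ r) (hr1 : r ≤ 1)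
    (hm : Marked (psi a b) e r (∅ : Finset (RS Fq n)) x)
    (v : Fin (n + 1) → Fq[X]) (hv : v ≠ 0) :
    e ≤ absK Fq (a * ∑ m, emb Fq (v m) * x ^ (m : ℕ)) ∨ ∃ k, k ≠ 0 ∧ e ≤ absK Fq (b * emb Fq (v k)) := by
  by_contra hcon
  push Not at hcon
  obtain ⟨h0, hk⟩ := hcon
  obtain ⟨F, _, hch, hin, hco⟩ := hm
  have hev : ev v ≠ 0 := by
    intro h
    apply hv
    funext i
    have := congrFun h i
    exact emb_injective (by simpa [ev] using this)
  -- the largest flag member not containing v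
  set S := (insert (botRS Fq n) F).filter (fun W => ev v ∉ W.1) with hS
  have hbotS : botRS Fq n ∈ S := by
    rw [hS, Finset.mem_filter]
    exact ⟨Finset.mem_insert_self _ _, by simpa [botRS] using hev⟩
  obtain ⟨V, hVS, hVmax⟩ := Finset.exists_maximal ⟨_, hbotS⟩
  rw [hS, Finset.mem_filter, Finset.mem_insert] at hVS
  obtain ⟨hVF, hvV⟩ := hVS
  have hbot : ∀ W : RS Fq n, botRS Fq n ≤ W := fun W => RS_le.2 bot_le
  have hcmp : ∀ f ∈ F, f ≤ V ∨ V ≤ f := by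
    intro f hf
    rcases hVF with h | h
    · right; rw [h]; exact hbot f
    · exact hch.total hf h
  have hpsiV : psi a b V x ≤ 1 := by
    rcases hVF with h | h
    · rw [h, psi_bot]
    · exact (hin V h (Finset.notMem_empty _)).2.le.trans hr1
  have hVV' : V ≤ addRS V v hvV := RS_le.2 le_sup_right
  have hpsi' : e ≤ psi a b (addRS V v hvV) x := by
    by_cases hmem : addRS V v hvV ∈ F
    · exact (hin _ hmem (Finset.notMem_empty _)).1
    · refine her.trans (hco _ ⟨hmem, fun f hf => ?_⟩)
      by_cases hvf : ev v ∈ f.1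
      · left
        have hVf : V ≤ f := by
          rcases hcmp f hf with h | h
          · exact absurd (h hvf) hvV
          · exact h
        refine RS_le.2 (sup_le ?_ hVf)
        rw [Submodule.span_singleton_le_iff_mem]; exact hvf
      · right
        have hfS : f ∈ S := by
          rw [hS, Finset.mem_filter]; exact ⟨Finset.mem_insert_of_mem hf, hvf⟩
        rcases hcmp f hf with h | h
        · exact h.trans hVV'
        · exact (hVmax hfS h).trans hVV'
  -- strict upper bound
  obtain ⟨k0, _, hk0⟩ := Finset.exists_max_image (Finset.univ : Finset (Fin (n + 1)))
    (fun k => if k = 0 then absK Fq (a * ∑ m, emb Fq (v m) * x ^ (m : ℕ)) else absK Fq (b * emb Fq (v k))) ⟨0, Finset.mem_univ _⟩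
  set s := (fun k => if k = 0 then absK Fq (a * ∑ m, emb Fq (v m) * x ^ (m : ℕ)) else absK Fq (b * emb Fq (v k))) k0 with hs
  have hs0 : 0 ≤ s := by
    simp only [hs]; split_ifs <;> exact absK_nonneg _
  have hse : s < e := by
    simp only [hs]; split_ifs with h
    · exact h0
    · exact hk k0 h
  have := psi_add a b x V v hvV s (by simpa using hk0 0 (Finset.mem_univ _)) (fun k hk' => by
    have := hk0 k (Finset.mem_univ _); simp only [if_neg hk'] at this; exact this)
  nlinarith [mx_nonneg (EM (bas V) * GM n a b x)]

variable [MeasurableSpace (K Fq)] [BorelSpace (K Fq)] (mu : Measure (K Fq)) [mu.IsAddHaarMeasure]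

lemma nondiv (n : ℕ) (eta : ENNReal) (heta : eta ≠ 0) : ∃ l : ℕ, ∀ a b : K Fq, absK Fq b ≤ 1 →
    1 ≤ absK Fq a * absK Fq b ^ n → ∀ N : ℕ,
    mu {x | x ∈ BB 0 (-(N : ℤ)) ∧ ∃ v : Fin (n + 1) → Fq[X], v ≠ 0 ∧
      absK Fq (a * ∑ m, emb Fq (v m) * x ^ (m : ℕ)) < qq Fq ^ (-(l : ℤ)) ∧
      ∀ k, k ≠ 0 → absK Fq (b * emb Fq (v k)) < qq Fq ^ (-(l : ℤ))} ≤ eta * mu (BB 0 (-(N : ℤ))) := by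
  obtain ⟨r, hr0, hr1, hr⟩ := coeff_lower (Fq := Fq) ((n + 1) * n)
  set D : ENNReal := kmC Fq (n + 2) * (((n + 1) * n : ℕ) : ENNReal) with hD
  have hDt : D ≠ ⊤ := ENNReal.mul_ne_top (kmC_ne_top _) (ENNReal.natCast_ne_top _)
  have hl1 : ∃ l1 : ℕ, D * ((Fintype.card Fq : ENNReal) ^ l1)⁻¹ ≤ eta := by
    have hlim : Filter.Tendsto (fun l : ℕ => D * ((Fintype.card Fq : ENNReal)⁻¹) ^ l) Filter.atTop (nhds (D * 0)) := by
      apply ENNReal.Tendsto.const_mul _ (Or.inr hDt)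
      apply ENNReal.tendsto_pow_atTop_nhds_zero_of_lt_one
      rw [ENNReal.inv_lt_one]
      exact_mod_cast Fintype.one_lt_card
    rw [mul_zero] at hlim
    obtain ⟨l, hl⟩ := (hlim.eventually (ge_mem_nhds (pos_iff_ne_zero.2 heta))).exists
    refine ⟨l, ?_⟩
    rw [ENNReal.inv_pow]
    exact hl
  obtain ⟨l1, hl1⟩ := hl1
  have hq := qq_pos (Fq := Fq)
  obtain ⟨l, hl⟩ := exists_qq_zpow_lt (Fq := Fq) (r := r * (qq Fq ^ (l1 * ((n + 1) * n)))⁻¹) (by positivity)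
  refine ⟨l, fun a b hb hab N => ?_⟩
  have her : qq Fq ^ (-(l : ℤ)) * qq Fq ^ (l1 * ((n + 1) * n)) ≤ r := by
    rw [← le_mul_inv_iff₀ (by positivity)]; exact hl.le
  have her1 : qq Fq ^ (-(l : ℤ)) ≤ r := by
    refine le_trans ?_ her
    exact le_mul_of_one_le_right (by positivity) (one_le_pow₀ one_lt_qq.le)
  have hkm := km mu (psi a b) (qq Fq ^ (-(l : ℤ))) r ((((n + 1) * n : ℕ) : ENNReal) * ((Fintype.card Fq : ENNReal) ^ l1)⁻¹) (n + 2)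
    RS_chain (fun s c k h => psi_good mu a b l1 _ r (by positivity) her s c k h) (psi_cont a b r) (n + 2) (∅ : Finset (RS Fq n))
    (by simp) (by simp) 0 (-(N : ℤ)) (fun s _ => by
      obtain ⟨y, hy, h⟩ := psi_sup r hr1 hr a b hb hab s
      exact ⟨y, BB_mono 0 (by omega) hy, h⟩)
  refine (measure_mono ?_).trans (hkm.trans ?_)
  · rintro x ⟨hx, v, hv, h1, h2⟩
    refine ⟨hx, fun hm => ?_⟩
    rcases marked_noshort a b x _ r her1 hr1 hm v hv with h | ⟨k, hk, h⟩
    · linarith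
    · linarith [h2 k hk]
  · gcongr
    rw [← mul_assoc]
    exact hl1

end Nondiv2

section AEGood

open MeasureTheory

def Bad (n h l : ℕ) : Set (K Fq) := {x | ∃ v : Fin (n + 1) → Fq[X], v ≠ 0 ∧
      absK Fq (Tvar Fq ^ (n * h) * ∑ m, emb Fq (v m) * x ^ (m : ℕ)) < qq Fq ^ (-(l : ℤ)) ∧
      ∀ k, k ≠ 0 → absK Fq ((Tvar Fq ^ h)⁻¹ * emb Fq (v k)) < qq Fq ^ (-(l : ℤ))}

lemma exists_mem_BB (x : K Fq) : ∃ N : ℕ, x ∈ BB (0 : K Fq) (-(N : ℤ)) := by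
  by_cases hx : x = 0
  · exact ⟨0, by rw [hx]; exact mem_BB_self _ _⟩
  · refine ⟨(-(HahnSeries.order x)).toNat, ?_⟩
    rw [BB_zero]
    intro m hm
    exact HahnSeries.coeff_eq_zero_of_lt_order (by omega)

variable [MeasurableSpace (K Fq)] [BorelSpace (K Fq)] (mu : Measure (K Fq)) [mu.IsAddHaarMeasure]

lemma ae_good (n : ℕ) : mu {x : K Fq | ∀ l, ∃ h0, ∀ h, h0 ≤ h → x ∈ Bad n h l} = 0 := by
  set Z := {x : K Fq | ∀ l, ∃ h0, ∀ h, h0 ≤ h → x ∈ Bad n h l} with hZ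
  have hq := qq_pos (Fq := Fq)
  have key : ∀ N : ℕ, mu (Z ∩ BB 0 (-(N : ℤ))) = 0 := by
    intro N
    have hle : ∀ eta : ENNReal, eta ≠ 0 → mu (Z ∩ BB 0 (-(N : ℤ))) ≤ eta * mu (BB 0 (-(N : ℤ))) := by
      intro eta heta
      obtain ⟨l, hl⟩ := nondiv mu n eta heta
      have hsub : Z ∩ BB 0 (-(N : ℤ)) ⊆ ⋃ h0 : ℕ, {x | x ∈ BB 0 (-(N : ℤ)) ∧ ∀ h, h0 ≤ h → x ∈ Bad n h l} := by
        rintro x ⟨hxZ, hxB⟩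
        obtain ⟨h0, hh⟩ := hxZ l
        exact Set.mem_iUnion.2 ⟨h0, hxB, hh⟩
      refine (measure_mono hsub).trans ?_
      rw [Monotone.measure_iUnion]
      · apply iSup_le
        intro h0
        refine (measure_mono ?_).trans (hl (Tvar Fq ^ (n * h0)) ((Tvar Fq ^ h0)⁻¹) ?_ ?_ N)
        · rintro x ⟨hx, h⟩
          exact ⟨hx, h h0 le_rfl⟩
        · rw [absK_inv, absK_pow, absK_Tvar]
          exact inv_le_one_of_one_le₀ (one_le_pow₀ one_lt_qq.le)
        · rw [absK_inv, absK_pow, absK_pow, absK_Tvar, inv_pow, ← pow_mul, mul_comm h0 n, mul_inv_cancel₀ (by positivity)]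
      · intro s t hst x hx
        exact ⟨hx.1, fun h hh => hx.2 h (hst.trans hh)⟩
    by_contra hne
    have hM := mu_BB_ne_top mu (0 : K Fq) (-(N : ℤ))
    have hM0 := (mu_BB_pos mu (0 : K Fq) (-(N : ℤ))).ne'
    set M := mu (BB (0 : K Fq) (-(N : ℤ)))
    set X := mu (Z ∩ BB 0 (-(N : ℤ)))
    have hXt : X ≠ ⊤ := ne_top_of_le_ne_top hM (by simpa using hle 1 one_ne_zero)
    have h1 := hle (X / 2 / M) (by
      apply ENNReal.div_ne_zero.2
      exact ⟨ENNReal.div_ne_zero.2 ⟨hne, by simp⟩, hM⟩)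
    rw [ENNReal.div_mul_cancel hM0 hM] at h1
    exact absurd h1 (not_le.2 (ENNReal.half_lt_self hne hXt))
  have : Z ⊆ ⋃ N : ℕ, Z ∩ BB 0 (-(N : ℤ)) := by
    intro x hx
    obtain ⟨N, hN⟩ := exists_mem_BB x
    exact Set.mem_iUnion.2 ⟨N, hx, hN⟩
  exact measure_mono_null this (measure_iUnion_null key)

end AEGood

section Approx

lemma poly_part (y : K Fq) : ∃ p : Fq[X], ∀ m : ℤ, m ≤ 0 → (emb Fq p).coeff m = y.coeff m := by
  obtain ⟨N, hN⟩ := exists_mem_BB y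
  rw [BB_zero] at hN
  refine ⟨∑ i ∈ Finset.range (N + 1), monomial i (y.coeff (-(i : ℤ))), fun m hm => ?_⟩
  rw [coeff_emb, if_pos hm, Polynomial.finsetSum_coeff]
  simp only [Polynomial.coeff_monomial]
  rw [Finset.sum_ite_eq']
  split_ifs with h
  · congr 1; omega
  · rw [Finset.mem_range] at h
    exact (hN m (by omega)).symm

lemma pigeon (n l L h M : ℕ) (hL : L ≤ h) (hM : M = l + n * L) (x : K Fq) :
    ∃ v : Fin (n + 2) → Fq[X], v ≠ 0 ∧
      absK Fq (∑ m, emb Fq (v m) * x ^ (m : ℕ)) < qq Fq ^ (-(((n + 1) * h + l : ℕ) : ℤ)) ∧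
      (v 1).degree < ((h + M + 1 : ℕ) : WithBot ℕ) ∧ ∀ i, i ≠ 0 → i ≠ 1 → (v i).degree < ((h - L : ℕ) : WithBot ℕ) := by
  let d : Fin (n + 1) → ℕ := fun i => if i = 0 then h + M + 1 else h - L
  let p : (∀ i, Fin (d i) → Fq) → Fin (n + 1) → Fq[X] := fun c i => ((Polynomial.degreeLTEquiv Fq (d i)).symm (c i)).1
  let S : (∀ i, Fin (d i) → Fq) → K Fq := fun c => ∑ i : Fin (n + 1), emb Fq (p c i) * x ^ ((i : ℕ) + 1)
  let g : (∀ i, Fin (d i) → Fq) → (Fin ((n + 1) * h + l) → Fq) := fun c m => (S c).coeff ((m : ℤ) + 1)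
  have hcard : Fintype.card (Fin ((n + 1) * h + l) → Fq) < Fintype.card (∀ i, Fin (d i) → Fq) := by
    rw [Fintype.card_fun, Fintype.card_fin, Fintype.card_pi]
    simp only [Fintype.card_fun, Fintype.card_fin]
    rw [Finset.prod_pow_eq_pow_sum]
    apply Nat.pow_lt_pow_right Fintype.one_lt_card
    rw [Fin.sum_univ_succ]
    simp only [d, if_true, Fin.succ_ne_zero, if_false, Finset.sum_const, Finset.card_univ, Fintype.card_fin, smul_eq_mul]
    obtain ⟨t, rfl⟩ := Nat.exists_eq_add_of_le hL
    rw [hM, Nat.add_sub_cancel_left]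
    nlinarith
  obtain ⟨c, c', hne, hg⟩ := Fintype.exists_ne_map_eq_of_card_lt g hcard
  obtain ⟨p0, hp0⟩ := poly_part (-(S c - S c'))
  refine ⟨Fin.cons p0 (fun i => p c i - p c' i), ?_, ?_, ?_, ?_⟩
  · intro h0
    apply hne
    funext i
    have := congrFun h0 i.succ
    simp only [Fin.cons_succ, Pi.zero_apply, sub_eq_zero] at this
    exact (Polynomial.degreeLTEquiv Fq (d i)).symm.injective (Subtype.ext this)
  · rw [Fin.sum_univ_succ]
    have h1 : ∑ i : Fin (n + 1), emb Fq ((Fin.cons p0 (fun i => p c i - p c' i) : Fin (n + 2) → Fq[X]) i.succ) * x ^ ((i.succ : Fin (n + 2)) : ℕ) = S c - S c' := by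
      simp only [S]
      rw [← Finset.sum_sub_distrib]
      apply Finset.sum_congr rfl
      intro i _
      simp only [Fin.cons_succ, map_sub, Fin.val_succ]
      ring
    rw [h1, ← mem_UU_succ_iff]
    simp only [Fin.cons_zero, Fin.val_zero, pow_zero, mul_one]
    intro m hm
    rw [HahnSeries.coeff_add]
    by_cases hm0 : m ≤ 0
    · rw [hp0 m hm0, HahnSeries.coeff_neg]; ring
    · rw [coeff_emb, if_neg hm0, zero_add, HahnSeries.coeff_sub, sub_eq_zero]
      have := congrFun hg ⟨(m - 1).toNat, by omega⟩
      simp only [g] at this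
      have h2 : (((m - 1).toNat : ℕ) : ℤ) + 1 = m := by omega
      rw [h2] at this
      exact this
  · have h1 : ∀ c, (p c 0).degree < ((h + M + 1 : ℕ) : WithBot ℕ) := fun c => by
      have := ((Polynomial.degreeLTEquiv Fq (d 0)).symm (c 0)).2
      rw [Polynomial.mem_degreeLT] at this
      exact this
    exact (Polynomial.degree_sub_le _ _).trans_lt (max_lt (h1 c) (h1 c'))
  · intro i hi0 hi1
    obtain ⟨j, rfl⟩ := Fin.exists_succ_eq.2 hi0
    have hj : j ≠ 0 := by rintro rfl; exact hi1 rfl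
    have h1 : ∀ c, (p c j).degree < ((h - L : ℕ) : WithBot ℕ) := fun c => by
      have := ((Polynomial.degreeLTEquiv Fq (d j)).symm (c j)).2
      rw [Polynomial.mem_degreeLT] at this
      have hd : d j = h - L := if_neg hj
      rw [← hd]
      exact this
    rw [Fin.cons_succ]
    exact (Polynomial.degree_sub_le _ _).trans_lt (max_lt (h1 c) (h1 c'))

/-- difference quotient with dominating linear coefficient -/
lemma diff_quot (n : ℕ) (a : Fin (n + 2) → K Fq) (Q : ℝ) (hQ : 1 ≤ Q)
    (ha1 : a 1 ≠ 0)
    (ha : ∀ i, i ≠ 0 → i ≠ 1 → absK Fq (a i) * Q ^ (n + 1) < absK Fq (a 1)) (x y : K Fq)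
    (hx : absK Fq x ≤ Q) (hy : absK Fq y ≤ Q) :
    ∃ s : K Fq, absK Fq s < absK Fq (a 1) ∧
      ∑ m, a m * x ^ (m : ℕ) - ∑ m, a m * y ^ (m : ℕ) = (a 1 + s) * (x - y) := by
  refine ⟨∑ i : Fin n, a i.succ.succ * ∑ t ∈ Finset.range ((i : ℕ) + 2), x ^ t * y ^ ((i : ℕ) + 2 - 1 - t), ?_, ?_⟩
  · apply absK_sum_lt _ _ (absK_pos ha1)
    intro i _
    refine lt_of_le_of_lt ?_ (ha i.succ.succ (Fin.succ_ne_zero _) (by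
      rw [← Fin.succ_zero_eq_one]; exact fun h => Fin.succ_ne_zero _ (Fin.succ_injective _ h)))
    rw [absK_mul]
    apply mul_le_mul_of_nonneg_left _ (absK_nonneg _)
    apply absK_sum_le _ _ (by positivity)
    intro t ht
    rw [Finset.mem_range] at ht
    rw [absK_mul, absK_pow, absK_pow]
    calc _ ≤ Q ^ t * Q ^ ((i : ℕ) + 2 - 1 - t) := by
          exact mul_le_mul (pow_le_pow_left₀ (absK_nonneg _) hx _)
            (pow_le_pow_left₀ (absK_nonneg _) hy _) (pow_nonneg (absK_nonneg _) _) (by positivity)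
      _ = Q ^ ((i : ℕ) + 1) := by rw [← pow_add]; congr 1; omega
      _ ≤ Q ^ (n + 1) := pow_le_pow_right₀ hQ (by omega)
  · rw [← Finset.sum_sub_distrib, Fin.sum_univ_succ, Fin.sum_univ_succ, add_mul, Finset.sum_mul]
    simp only [Fin.val_zero, pow_zero, sub_self, zero_add, Fin.succ_zero_eq_one, Fin.val_one, pow_one, Fin.val_succ]
    congr 1
    · ring
    · apply Finset.sum_congr rfl
      intro i _
      rw [mul_assoc, (Commute.all x y).geom_sum₂_mul]
      ring

lemma exists_root (n : ℕ) (a : Fin (n + 2) → K Fq) (N : ℕ) (ha1 : 1 ≤ absK Fq (a 1))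
    (ha : ∀ i, i ≠ 0 → i ≠ 1 → absK Fq (a i) * (qq Fq ^ N) ^ (n + 1) < absK Fq (a 1)) (x : K Fq)
    (hx : x ∈ BB (0 : K Fq) (-(N : ℤ))) (hfx : absK Fq (∑ m, a m * x ^ (m : ℕ)) ≤ 1) :
    ∃ y, ∑ m, a m * y ^ (m : ℕ) = 0 ∧ absK Fq (x - y) * absK Fq (a 1) = absK Fq (∑ m, a m * x ^ (m : ℕ)) := by
  have hQ : (1 : ℝ) ≤ qq Fq ^ N := one_le_pow₀ one_lt_qq.le
  have ha0 : a 1 ≠ 0 := by intro h; rw [h, absK_zero] at ha1; linarith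
  have hball : ∀ z, z ∈ BB (0 : K Fq) (-(N : ℤ)) ↔ absK Fq z ≤ qq Fq ^ N := by
    intro z
    rw [BB_zero, SetLike.mem_coe, mem_UU_iff, neg_neg, zpow_natCast]
  set f : K Fq → K Fq := fun z => ∑ m, a m * z ^ (m : ℕ) with hf
  have hcont : Continuous fun z => absK Fq (f z) := by
    apply continuous_absK.comp
    rw [hf]
    fun_prop
  have hcpt : IsCompact (BB (0 : K Fq) (-(N : ℤ))) := by rw [BB_zero]; exact isCompact_UU _
  obtain ⟨y, hy, hmin⟩ := hcpt.exists_isMinOn ⟨x, hx⟩ hcont.continuousOn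
  have hmin' : ∀ z ∈ BB (0 : K Fq) (-(N : ℤ)), absK Fq (f y) ≤ absK Fq (f z) := fun z hz => hmin hz
  have hfy : f y = 0 := by
    by_contra hne
    have hz : y - f y / a 1 ∈ BB (0 : K Fq) (-(N : ℤ)) := by
      rw [hball]
      refine (absK_sub_le _ _).trans (max_le ((hball y).1 hy) ?_)
      rw [absK_div, div_le_iff₀ (by linarith)]
      have : absK Fq (f y) ≤ 1 := (hmin' x hx).trans hfx
      nlinarith
    obtain ⟨s, hs, heq⟩ := diff_quot n a _ hQ ha0 ha (y - f y / a 1) y ((hball _).1 hz) ((hball _).1 hy)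
    have h2 : f (y - f y / a 1) = - (s * (f y / a 1)) := by
      have : f (y - f y / a 1) - f y = (a 1 + s) * (y - f y / a 1 - y) := heq
      have h3 : f (y - f y / a 1) = f y + (a 1 + s) * (y - f y / a 1 - y) := by rw [← this]; ring
      rw [h3]; field_simp; ring
    have h4 := hmin' _ hz
    rw [h2, absK_neg, absK_mul, absK_div] at h4
    have h5 := absK_pos hne
    have h6 : absK Fq s * (absK Fq (f y) / absK Fq (a 1)) < absK Fq (f y) := by
      rw [mul_div_assoc', div_lt_iff₀ (by linarith)]
      nlinarith
    linarith
  refine ⟨y, hfy, ?_⟩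
  obtain ⟨s, hs, heq⟩ := diff_quot n a _ hQ ha0 ha x y ((hball _).1 hx) ((hball _).1 hy)
  have h1 : f x = (a 1 + s) * (x - y) := by
    rw [← heq]; change f x = f x - f y; rw [hfy, sub_zero]
  change _ = absK Fq (f x)
  rw [h1, absK_mul, absK_add_eq hs, mul_comm]

end Approx

section RootExists

lemma absK_emb_of_degree_lt {p : Fq[X]} {m : ℕ} (h : p.degree < ((m : ℕ) : WithBot ℕ)) :
    absK Fq (emb Fq p) < qq Fq ^ m := by
  by_cases hp : p = 0
  · rw [hp, map_zero, absK_zero]; exact pow_pos qq_pos _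
  · rw [absK_emb hp]
    have := (Polynomial.natDegree_lt_iff_degree_lt hp).2 h
    exact pow_lt_pow_right₀ one_lt_qq this

lemma natDegree_le_of_absK {p : Fq[X]} {m : ℕ} (h : absK Fq (emb Fq p) ≤ qq Fq ^ m) :
    p.natDegree ≤ m := by
  by_cases hp : p = 0
  · simp [hp]
  · rw [absK_emb hp] at h
    exact (pow_le_pow_iff_right₀ one_lt_qq).1 h

lemma HP_le_of {P : Fq[X][X]} {m : ℕ} (h : ∀ i, (P.coeff i).natDegree ≤ m) :
    HP Fq P ≤ qq Fq ^ m := by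
  unfold HP
  exact pow_le_pow_right₀ one_lt_qq.le (Finset.sup_le fun i _ => h i)

lemma root_exists (n N l : ℕ) : ∃ c h1 : ℕ, ∀ ξ ∈ BB (0 : K Fq) (-(N : ℤ)), ∀ h, h1 ≤ h →
    ξ ∉ Bad (n + 1) h l → ∃ P : Fq[X][X], P ≠ 0 ∧ P.natDegree ≤ n + 1 ∧ HP Fq P ≤ qq Fq ^ (h + c) ∧
      ∃ α, evalK Fq P α = 0 ∧ absK Fq (ξ - α) < qq Fq ^ (-(((n + 2) * h : ℕ) : ℤ)) := by
  set L := l + N * (n + 1) with hL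
  set M := l + n * L with hM
  refine ⟨M + 1 + N * (n + 1), L, fun ξ hξ h hh hbad => ?_⟩
  have hq0 : (0 : ℝ) < qq Fq := qq_pos
  have hq1 : (1 : ℝ) < qq Fq := one_lt_qq
  obtain ⟨v, hv0, hvx, hv1, hvi⟩ := pigeon n l L h M hh hM ξ
  have hlh : l ≤ h := by have : l ≤ L := Nat.le_add_right _ _; omega
  have hvi' : ∀ i, i ≠ 0 → i ≠ 1 → absK Fq (emb Fq (v i)) < qq Fq ^ (h - L) := fun i h0 h1 =>
    absK_emb_of_degree_lt (hvi i h0 h1)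
  have hv1' := absK_emb_of_degree_lt hv1
  -- linear coefficient is large
  have hbig : qq Fq ^ (h - l) ≤ absK Fq (emb Fq (v 1)) := by
    by_contra hlt
    push Not at hlt
    apply hbad
    refine ⟨v, hv0, ?_, ?_⟩
    · rw [absK_mul, absK_pow, absK_Tvar, ← zpow_natCast]
      calc _ < qq Fq ^ (((n + 1) * h : ℕ) : ℤ) * qq Fq ^ (-(((n + 1) * h + l : ℕ) : ℤ)) :=
            mul_lt_mul_of_pos_left hvx (zpow_pos hq0 _)
        _ = _ := by rw [← zpow_add₀ hq0.ne']; congr 1; push_cast; ring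
    · intro k hk
      have hk' : absK Fq (emb Fq (v k)) < qq Fq ^ (h - l) := by
        by_cases hk1 : k = 1
        · rw [hk1]; exact hlt
        · exact (hvi' k hk hk1).trans_le (pow_le_pow_right₀ hq1.le (by omega))
      rw [absK_mul, absK_inv, absK_pow, absK_Tvar]
      calc _ < (qq Fq ^ h)⁻¹ * qq Fq ^ (h - l) := mul_lt_mul_of_pos_left hk' (by positivity)
        _ = _ := by
          rw [← zpow_natCast, ← zpow_natCast, ← zpow_neg, ← zpow_add₀ hq0.ne']
          congr 1; push_cast [hlh]; ring
  have h1 : 1 ≤ absK Fq (emb Fq (v 1)) := (one_le_pow₀ hq1.le).trans hbig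
  have hsum1 : absK Fq (∑ m, emb Fq (v m) * ξ ^ (m : ℕ)) ≤ 1 := by
    refine hvx.le.trans ?_
    rw [zpow_neg, zpow_natCast]
    exact inv_le_one_of_one_le₀ (one_le_pow₀ hq1.le)
  obtain ⟨α, hα, hdist⟩ := exists_root n (fun m => emb Fq (v m)) N h1 (by
    intro i h0 h1
    calc _ < qq Fq ^ (h - L) * (qq Fq ^ N) ^ (n + 1) :=
          mul_lt_mul_of_pos_right (hvi' i h0 h1) (by positivity)
      _ = qq Fq ^ (h - l) := by
          rw [← pow_mul, ← pow_add]; congr 1; omega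
      _ ≤ _ := hbig) ξ hξ hsum1
  have hξ' : absK Fq ξ ≤ qq Fq ^ N := by
    rw [BB_zero, SetLike.mem_coe, mem_UU_iff, neg_neg, zpow_natCast] at hξ
    exact hξ
  have hall : ∀ m, absK Fq (emb Fq (v m)) ≤ qq Fq ^ (h + (M + 1 + N * (n + 1))) := by
    have hne : ∀ m, m ≠ 0 → absK Fq (emb Fq (v m)) ≤ qq Fq ^ (h + M + 1) := by
      intro m hm
      by_cases hm1 : m = 1
      · rw [hm1]; exact hv1'.le
      · exact (hvi' m hm hm1).le.trans (pow_le_pow_right₀ hq1.le (by omega))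
    intro m
    by_cases hm : m = 0
    · subst hm
      have h2 : emb Fq (v 0) = (∑ m, emb Fq (v m) * ξ ^ (m : ℕ)) - ∑ m : Fin (n + 1), emb Fq (v m.succ) * ξ ^ ((m : ℕ) + 1) := by
        rw [Fin.sum_univ_succ]
        simp
      rw [h2]
      refine (absK_sub_le _ _).trans (max_le ?_ ?_)
      · exact hsum1.trans (one_le_pow₀ hq1.le)
      · apply absK_sum_le _ _ (by positivity)
        intro i _
        rw [absK_mul, absK_pow]
        calc _ ≤ qq Fq ^ (h + M + 1) * (qq Fq ^ N) ^ ((i : ℕ) + 1) :=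
              mul_le_mul (hne _ (Fin.succ_ne_zero _)) (pow_le_pow_left₀ (absK_nonneg _) hξ' _)
                (pow_nonneg (absK_nonneg _) _) (by positivity)
          _ ≤ qq Fq ^ (h + M + 1) * (qq Fq ^ N) ^ (n + 1) := by
              apply mul_le_mul_of_nonneg_left _ (by positivity)
              exact pow_le_pow_right₀ (one_le_pow₀ hq1.le) (by omega)
          _ = _ := by rw [← pow_mul, ← pow_add]; congr 1; ring
    · exact (hne m hm).trans (pow_le_pow_right₀ hq1.le (by nlinarith))
  have hcoeff : ∀ i, (∑ m : Fin (n + 2), monomial (m : ℕ) (v m) : Fq[X][X]).coeff i = if hi : i < n + 2 then v ⟨i, hi⟩ else 0 := by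
    intro i
    rw [Polynomial.finsetSum_coeff]
    simp only [Polynomial.coeff_monomial]
    split_ifs with hi
    · rw [Finset.sum_eq_single ⟨i, hi⟩]
      · simp
      · intro b _ hb
        rw [if_neg]
        intro h; exact hb (Fin.ext h)
      · simp
    · apply Finset.sum_eq_zero
      intro m _
      rw [if_neg]
      omega
  refine ⟨∑ m : Fin (n + 2), monomial (m : ℕ) (v m), ?_, ?_, ?_, α, ?_, ?_⟩
  · intro h0
    apply hv0
    funext m
    have := hcoeff m
    rw [h0, dif_pos m.2] at this
    simpa using this.symm
  · rw [Polynomial.natDegree_le_iff_coeff_eq_zero]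
    intro i hi
    rw [hcoeff, dif_neg (by omega)]
  · apply HP_le_of
    intro i
    rw [hcoeff]
    split_ifs
    · exact natDegree_le_of_absK (hall _)
    · simp
  · rw [← hα]
    simp [evalK, Polynomial.eval₂_finsetSum, Polynomial.eval₂_monomial]
  · by_contra hlt
    push Not at hlt
    have : qq Fq ^ (-(((n + 1) * h + l : ℕ) : ℤ)) ≤ absK Fq (ξ - α) * absK Fq (emb Fq (v 1)) := by
      calc _ = qq Fq ^ (-(((n + 2) * h : ℕ) : ℤ)) * qq Fq ^ (h - l) := by
            rw [← zpow_natCast, ← zpow_add₀ hq0.ne']; congr 1; push_cast [hlh]; ring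
        _ ≤ _ := mul_le_mul hlt hbig (by positivity) (absK_nonneg _)
    rw [hdist] at this
    exact absurd hvx (not_lt.2 this)

end RootExists

section Heights

/-- degree in `T` -/
def tdeg (P : Fq[X][X]) : ℕ := P.support.sup fun i => (P.coeff i).natDegree

lemma HP_eq (P : Fq[X][X]) : HP Fq P = qq Fq ^ tdeg P := rfl

lemma one_le_HP (P : Fq[X][X]) : 1 ≤ HP Fq P := one_le_pow₀ one_lt_qq.le

lemma tdeg_le_iff (P : Fq[X][X]) (d : ℕ) : tdeg P ≤ d ↔ ∀ i, (P.coeff i).natDegree ≤ d := by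
  unfold tdeg
  rw [Finset.sup_le_iff]
  constructor
  · intro h i
    by_cases hi : i ∈ P.support
    · exact h i hi
    · rw [Polynomial.notMem_support_iff] at hi; simp [hi]
  · intro h i _; exact h i

lemma coeff_swap (P : Fq[X][X]) (i j : ℕ) :
    ((Polynomial.Bivariate.swap P).coeff i).coeff j = (P.coeff j).coeff i := by
  induction P using Polynomial.induction_on' with
  | add p q hp hq => simp only [map_add, Polynomial.coeff_add, hp, hq]
  | monomial n f =>
    induction f using Polynomial.induction_on' with
    | add p q hp hq => simp only [map_add, Polynomial.coeff_add, hp, hq]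
    | monomial m r =>
      rw [Polynomial.Bivariate.swap_monomial_monomial]
      simp only [Polynomial.coeff_monomial]
      by_cases h1 : m = i <;> by_cases h2 : n = j <;> simp [h1, h2, Polynomial.coeff_monomial]

lemma tdeg_eq (P : Fq[X][X]) : tdeg P = (Polynomial.Bivariate.swap P).natDegree := by
  apply eq_of_forall_ge_iff
  intro d
  rw [tdeg_le_iff, Polynomial.natDegree_le_iff_coeff_eq_zero]
  simp only [Polynomial.natDegree_le_iff_coeff_eq_zero]
  constructor
  · intro h i hi
    ext j
    rw [coeff_swap, h j i hi]; simp
  · intro h j i hi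
    rw [← coeff_swap, h i hi]; simp

lemma tdeg_le_of_dvd {Q P : Fq[X][X]} (hP : P ≠ 0) (h : Q ∣ P) : tdeg Q ≤ tdeg P := by
  rw [tdeg_eq, tdeg_eq]
  apply Polynomial.natDegree_le_of_dvd
  · obtain ⟨S, rfl⟩ := h
    rw [map_mul]
    exact dvd_mul_right _ _
  · intro h0
    apply hP
    ext i j
    rw [← coeff_swap, h0]; simp

lemma exists_irred {P : Fq[X][X]} (hP : P ≠ 0) {α : K Fq} (h : evalK Fq P α = 0) :
    ∃ Q, Irreducible Q ∧ Q ∣ P ∧ evalK Fq Q α = 0 := by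
  obtain ⟨f, hf, hfP⟩ := WfDvdMonoid.exists_factors P hP
  let φ := Polynomial.eval₂RingHom (emb Fq) α
  have h0 : φ f.prod = 0 := by
    obtain ⟨u, hu⟩ := hfP
    have h1 : φ f.prod * φ u = 0 := by rw [← map_mul, hu]; exact h
    exact (mul_eq_zero.1 h1).resolve_right (u.isUnit.map φ).ne_zero
  rw [map_multiset_prod, Multiset.prod_eq_zero_iff, Multiset.mem_map] at h0
  obtain ⟨Q, hQ, hQ0⟩ := h0
  exact ⟨Q, hf Q hQ, (Multiset.dvd_prod hQ).trans hfP.dvd, hQ0⟩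

lemma irred_natDegree_ne {Q : Fq[X][X]} (hQ : Irreducible Q) {α : K Fq} (h : evalK Fq Q α = 0) :
    Q.natDegree ≠ 0 := by
  intro h0
  rw [Polynomial.eq_C_of_natDegree_eq_zero h0] at h
  unfold evalK at h
  rw [Polynomial.eval₂_C] at h
  have : Q.coeff 0 = 0 := emb_injective (by rw [h, map_zero])
  apply hQ.ne_zero
  rw [Polynomial.eq_C_of_natDegree_eq_zero h0, this, map_zero]

lemma irred_natDegree_eq_aux {A L : Type} [CommRing A] [IsDomain A] [NormalizedGCDMonoid A] [Field L]
    (g : A →+* L) (hg : Function.Injective g) {Q R : A[X]} (hQ : Irreducible Q) (hR : Irreducible R)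
    (hQp : Q.IsPrimitive) (hRp : R.IsPrimitive) (α : L) (hQα : Q.eval₂ g α = 0)
    (hRα : R.eval₂ g α = 0) : Q.natDegree = R.natDegree := by
  have hinj : Function.Injective (algebraMap A (FractionRing A)) := IsFractionRing.injective _ _
  have hQ' := (hQp.irreducible_iff_irreducible_map_fraction_map (K := FractionRing A)).1 hQ
  have hR' := (hRp.irreducible_iff_irreducible_map_fraction_map (K := FractionRing A)).1 hR
  let ψ : FractionRing A →+* L := IsFractionRing.lift (g := g) hg
  have hcomp : ψ.comp (algebraMap A (FractionRing A)) = g :=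
    RingHom.ext fun x => IsFractionRing.lift_algebraMap hg x
  have hψ : ∀ P : A[X], (P.map (algebraMap A (FractionRing A))).eval₂ ψ α = P.eval₂ g α := by
    intro P
    rw [Polynomial.eval₂_map, hcomp]
  rcases hQ'.isCoprime_or_dvd (R.map (algebraMap A (FractionRing A))) with hc | hd
  · exfalso
    obtain ⟨a, b, hab⟩ := hc
    have := congrArg (Polynomial.eval₂ ψ α) hab
    rw [Polynomial.eval₂_add, Polynomial.eval₂_mul, Polynomial.eval₂_mul, hψ, hψ, hQα, hRα] at this
    simp at this
  · have := (hQ'.associated_of_dvd hR' hd)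
    have h2 := Polynomial.natDegree_eq_of_degree_eq (Polynomial.degree_eq_degree_of_associated this)
    rwa [Polynomial.natDegree_map_eq_of_injective hinj, Polynomial.natDegree_map_eq_of_injective hinj] at h2

lemma irred_natDegree_eq {Q R : Fq[X][X]} (hQ : Irreducible Q) (hR : Irreducible R) {α : K Fq}
    (hQα : evalK Fq Q α = 0) (hRα : evalK Fq R α = 0) : Q.natDegree = R.natDegree := by
  let _ : NormalizedGCDMonoid Fq[X] := Classical.choice inferInstance
  exact irred_natDegree_eq_aux (emb Fq) emb_injective hQ hR
    (hQ.isPrimitive (irred_natDegree_ne hQ hQα)) (hR.isPrimitive (irred_natDegree_ne hR hRα)) α hQα hRα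

lemma degA_le {P : Fq[X][X]} (hP : P ≠ 0) {α : K Fq} (h : evalK Fq P α = 0) :
    degA Fq α ≤ P.natDegree := Nat.sInf_le ⟨P, hP, rfl, h⟩

lemma irred_degA {Q : Fq[X][X]} (hQ : Irreducible Q) {α : K Fq} (h : evalK Fq Q α = 0) :
    Q.natDegree = degA Fq α := by
  apply le_antisymm _ (degA_le hQ.ne_zero h)
  obtain ⟨P, hP, hd, hα⟩ := Nat.sInf_mem (s := {d | ∃ P : Fq[X][X], P ≠ 0 ∧ P.natDegree = d ∧ evalK Fq P α = 0}) ⟨_, Q, hQ.ne_zero, rfl, h⟩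
  obtain ⟨R, hR, hRP, hRα⟩ := exists_irred hP hα
  rw [irred_natDegree_eq hQ hR h hRα]
  refine (Polynomial.natDegree_le_of_dvd hRP hP).trans ?_
  exact hd.le

lemma HA_le {P : Fq[X][X]} (hP : P ≠ 0) {α : K Fq} (h : evalK Fq P α = 0) : HA Fq α ≤ HP Fq P := by
  obtain ⟨Q, hQ, hQP, hQα⟩ := exists_irred hP h
  refine le_trans (csInf_le ⟨0, ?_⟩ ⟨Q, hQ.ne_zero, irred_degA hQ hQα, hQα, rfl⟩) ?_
  · rintro x ⟨R, _, _, _, rfl⟩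
    exact zero_le_one.trans (one_le_HP R)
  · rw [HP_eq, HP_eq]
    exact pow_le_pow_right₀ one_lt_qq.le (tdeg_le_of_dvd hP hQP)

lemma HA_attained {α : K Fq} (h : IsAlgK Fq α) :
    ∃ P : Fq[X][X], P ≠ 0 ∧ P.natDegree = degA Fq α ∧ evalK Fq P α = 0 ∧ HA Fq α = HP Fq P := by
  obtain ⟨P, hP, hPα⟩ := h
  obtain ⟨Q, hQ, hQP, hQα⟩ := exists_irred hP hPα
  have hex : ∃ t, ∃ R : Fq[X][X], R ≠ 0 ∧ R.natDegree = degA Fq α ∧ evalK Fq R α = 0 ∧ tdeg R = t :=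
    ⟨_, Q, hQ.ne_zero, irred_degA hQ hQα, hQα, rfl⟩
  obtain ⟨R, hR0, hRd, hRα, hRt⟩ := Nat.find_spec hex
  refine ⟨R, hR0, hRd, hRα, le_antisymm (HA_le hR0 hRα) ?_⟩
  have hne : {h | ∃ P : Fq[X][X],
      P ≠ 0 ∧ P.natDegree = degA Fq α ∧ evalK Fq P α = 0 ∧ h = HP Fq P}.Nonempty :=
    ⟨HP Fq R, R, hR0, hRd, hRα, rfl⟩
  apply le_csInf hne
  rintro x ⟨S, hS0, hSd, hSα, rfl⟩
  rw [HP_eq, HP_eq, hRt]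
  exact pow_le_pow_right₀ one_lt_qq.le (Nat.find_min' hex ⟨S, hS0, hSd, hSα, rfl⟩)

end Heights

section Upper

open MeasureTheory

lemma evalK_eq_eval (P : Fq[X][X]) (α : K Fq) : evalK Fq P α = (P.map (emb Fq)).eval α := by
  unfold evalK
  rw [Polynomial.eval_map]

def Rt (n h : ℕ) : Set (K Fq) :=
  {α | ∃ P : Fq[X][X], P ≠ 0 ∧ P.natDegree ≤ n ∧ tdeg P ≤ h ∧ evalK Fq P α = 0}

def polyOf (n h : ℕ) (c : Fin (n + 1) → Fin (h + 1) → Fq) : Fq[X][X] :=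
  ∑ i : Fin (n + 1), monomial (i : ℕ) (∑ j : Fin (h + 1), monomial (j : ℕ) (c i j))

lemma sum_monomial_eq {R : Type} [Semiring R] (p : R[X]) (n : ℕ) (h : p.natDegree ≤ n) :
    ∑ i : Fin (n + 1), monomial (i : ℕ) (p.coeff i) = p := by
  rw [Fin.sum_univ_eq_sum_range (fun i => monomial i (p.coeff i)) (n + 1)]
  exact (p.as_sum_range' (n + 1) (by omega)).symm

lemma exists_polyOf (n h : ℕ) (P : Fq[X][X]) (hn : P.natDegree ≤ n) (hh : tdeg P ≤ h) :
    ∃ c, polyOf n h c = P := by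
  refine ⟨fun i j => (P.coeff i).coeff j, ?_⟩
  unfold polyOf
  rw [tdeg_le_iff] at hh
  have : ∀ i : Fin (n + 1), ∑ j : Fin (h + 1), monomial (j : ℕ) ((P.coeff i).coeff j) = P.coeff i :=
    fun i => sum_monomial_eq _ _ (hh i)
  simp only [this]
  exact sum_monomial_eq _ _ hn

lemma natDegree_polyOf (n h : ℕ) (c : Fin (n + 1) → Fin (h + 1) → Fq) : (polyOf n h c).natDegree ≤ n := by
  unfold polyOf
  apply Polynomial.natDegree_sum_le_of_forall_le
  intro i _
  exact (Polynomial.natDegree_monomial_le _).trans (by omega)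

lemma Rt_finset (n h : ℕ) : ∃ s : Finset (K Fq), Rt n h ⊆ (↑s : Set (K Fq)) ∧
    s.card ≤ Fintype.card Fq ^ ((h + 1) * (n + 1)) * n := by
  refine ⟨Finset.univ.biUnion fun c : Fin (n + 1) → Fin (h + 1) → Fq =>
    ((polyOf n h c).map (emb Fq)).roots.toFinset, ?_, ?_⟩
  · rintro α ⟨P, hP0, hPn, hPh, hPα⟩
    obtain ⟨c, rfl⟩ := exists_polyOf n h P hPn hPh
    rw [Finset.mem_coe, Finset.mem_biUnion]
    refine ⟨c, Finset.mem_univ _, ?_⟩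
    rw [Multiset.mem_toFinset, Polynomial.mem_roots']
    refine ⟨(Polynomial.map_ne_zero_iff emb_injective).2 hP0, ?_⟩
    rw [Polynomial.IsRoot.def, ← evalK_eq_eval, hPα]
  · refine (Finset.card_biUnion_le_card_mul _ _ n ?_).trans ?_
    · intro c _
      refine (Multiset.toFinset_card_le _).trans ((Polynomial.card_roots' _).trans ?_)
      exact (Polynomial.natDegree_map_le).trans (natDegree_polyOf n h c)
    · apply Nat.mul_le_mul_right
      rw [Finset.card_univ, Fintype.card_fun, Fintype.card_fun, Fintype.card_fin, Fintype.card_fin, ← pow_mul]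

def EE (n j h : ℕ) : Set (K Fq) :=
  {ξ | ∃ α ∈ Rt n h, ξ ∈ BB α ((h * (n + 1) + h / (j + 1) : ℕ) : ℤ)}

lemma tsum_div (m : ℕ) (hm : m ≠ 0) (f : ℕ → ENNReal) : ∑' h, f (h / m) = m * ∑' k, f k := by
  have : NeZero m := ⟨hm⟩
  have h1 : ∑' h, f (h / m) = ∑' p : ℕ × Fin m, f p.1 := by
    rw [← (Nat.divModEquiv m).tsum_eq]
    rfl
  rw [h1, ENNReal.tsum_prod (f := fun k (_ : Fin m) => f k)]
  simp only [ENNReal.tsum_const, ENat.card_eq_coe_fintype_card, Fintype.card_fin]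
  rw [← ENNReal.tsum_mul_left]
  rfl

variable [MeasurableSpace (K Fq)] [BorelSpace (K Fq)] (mu : Measure (K Fq)) [mu.IsAddHaarMeasure]

lemma mu_EE (n j h : ℕ) : mu (EE n j h : Set (K Fq)) ≤
    ((Fintype.card Fq : ENNReal) ^ (n + 1) * n * mu (BB 0 0)) * ((Fintype.card Fq : ENNReal)⁻¹) ^ (h / (j + 1)) := by
  obtain ⟨s, hs, hcard⟩ := Rt_finset (Fq := Fq) n h
  have hsub : (EE n j h : Set (K Fq)) ⊆ ⋃ α ∈ s, BB α ((h * (n + 1) + h / (j + 1) : ℕ) : ℤ) := by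
    rintro ξ ⟨α, hα, hξ⟩
    exact Set.mem_biUnion (hs hα) hξ
  refine (measure_mono hsub).trans ((measure_biUnion_finset_le _ _).trans ?_)
  simp only [mu_BB mu]
  rw [Finset.sum_const, nsmul_eq_mul]
  have hb := mu_BB_add' mu 0 (h * (n + 1) + h / (j + 1))
  rw [zero_add] at hb
  rw [hb]
  have hq0 : (Fintype.card Fq : ENNReal) ≠ 0 := by simp
  have hqt : (Fintype.card Fq : ENNReal) ≠ ⊤ := ENNReal.natCast_ne_top _
  have hcard' : (s.card : ENNReal) ≤ (Fintype.card Fq : ENNReal) ^ ((h + 1) * (n + 1)) * n := by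
    exact_mod_cast hcard
  refine (mul_le_mul_left hcard' _).trans (le_of_eq ?_)
  have h1 : (h + 1) * (n + 1) = h * (n + 1) + (n + 1) := by ring
  rw [h1, pow_add _ (h * (n + 1)) (n + 1), pow_add _ (h * (n + 1)) (h / (j + 1)), ENNReal.mul_inv (Or.inr (ENNReal.pow_ne_top hqt)) (Or.inl (ENNReal.pow_ne_top hqt)), ← ENNReal.inv_pow (a := (Fintype.card Fq : ENNReal)) (n := h / (j + 1))]
  have h2 : (Fintype.card Fq : ENNReal) ^ (h * (n + 1)) * ((Fintype.card Fq : ENNReal) ^ (h * (n + 1)))⁻¹ = 1 :=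
    ENNReal.mul_inv_cancel (pow_ne_zero _ hq0) (ENNReal.pow_ne_top hqt)
  calc _ = ((Fintype.card Fq : ENNReal) ^ (h * (n + 1)) * ((Fintype.card Fq : ENNReal) ^ (h * (n + 1)))⁻¹) * (((Fintype.card Fq : ENNReal) ^ (n + 1) * n * mu (BB 0 0)) * ((Fintype.card Fq : ENNReal) ^ (h / (j + 1)))⁻¹) := by ring
    _ = _ := by rw [h2, one_mul]

lemma ae_upper (n j : ℕ) : mu {ξ : K Fq | ∃ᶠ h in Filter.atTop, ξ ∈ (EE n j h : Set (K Fq))} = 0 := by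
  apply measure_setOfPred_frequently_eq_zero
  apply ne_top_of_le_ne_top _ (ENNReal.tsum_le_tsum fun h => mu_EE mu n j h)
  rw [ENNReal.tsum_mul_left, tsum_div (j + 1) (by omega) (fun k => ((Fintype.card Fq : ENNReal)⁻¹) ^ k), ENNReal.tsum_geometric]
  have hqt : (Fintype.card Fq : ENNReal) ≠ ⊤ := ENNReal.natCast_ne_top _
  refine ENNReal.mul_ne_top (ENNReal.mul_ne_top (ENNReal.mul_ne_top (ENNReal.pow_ne_top hqt) (ENNReal.natCast_ne_top _)) (mu_BB_ne_top mu _ _)) (ENNReal.mul_ne_top (ENNReal.natCast_ne_top _) ?_)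
  rw [ENNReal.inv_ne_top]
  have : (Fintype.card Fq : ENNReal)⁻¹ < 1 := by
    rw [ENNReal.inv_lt_one]
    exact_mod_cast (Fintype.one_lt_card : 1 < Fintype.card Fq)
  exact (tsub_pos_of_lt this).ne'

end Upper

section Final

open MeasureTheory

lemma BB_of_absK_lt {ξ α : K Fq} {r : ℕ} (h : absK Fq (ξ - α) ≤ qq Fq ^ (-(r : ℤ))) :
    ξ ∈ BB α (r : ℤ) := by
  change ξ - α ∈ UU _
  rw [mem_UU_iff]
  exact h

lemma mem_Rt_of_isAlg {α : K Fq} (h : IsAlgK Fq α) {n : ℕ} (hn : degA Fq α ≤ n) :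
    ∃ t : ℕ, HA Fq α = qq Fq ^ t ∧ α ∈ Rt n t := by
  obtain ⟨P, hP0, hPd, hPα, hPH⟩ := HA_attained h
  exact ⟨tdeg P, hPH, P, hP0, hPd.le.trans hn, le_rfl, hPα⟩

lemma not_isAlg {ξ : K Fq} (h : ∀ n, ¬ ∃ᶠ h in Filter.atTop, ξ ∈ (EE n 0 h : Set (K Fq))) :
    ¬ IsAlgK Fq ξ := by
  rintro ⟨P, hP0, hPξ⟩
  apply h P.natDegree
  apply Filter.Eventually.frequently
  filter_upwards [Filter.eventually_ge_atTop (tdeg P)] with t ht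
  exact ⟨ξ, ⟨P, hP0, le_rfl, ht, hPξ⟩, mem_BB_self _ _⟩

lemma upper_aux {ξ : K Fq} {n j : ℕ} (h : ¬ ∃ᶠ h in Filter.atTop, ξ ∈ (EE n j h : Set (K Fq)))
    {w : ℝ} (hw : w ∈ wnstarSet Fq ξ n) : w < n + 1 / ((j : ℝ) + 1) := by
  by_contra hle
  push Not at hle
  rw [Filter.not_frequently, Filter.eventually_atTop] at h
  obtain ⟨h0, hh0⟩ := h
  apply hw
  have hfin : (⋃ t ∈ Set.Iio h0, (Rt n t : Set (K Fq))).Finite := by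
    apply Set.Finite.biUnion (Set.finite_Iio h0)
    intro t _
    obtain ⟨s, hs, -⟩ := Rt_finset (Fq := Fq) n t
    exact s.finite_toSet.subset hs
  refine hfin.subset ?_
  rintro α ⟨hα, hd, -, hlt⟩
  obtain ⟨t, ht, hRt⟩ := mem_Rt_of_isAlg hα hd
  refine Set.mem_biUnion (x := t) ?_ hRt
  by_contra hge
  rw [Set.mem_Iio, not_lt] at hge
  refine hh0 t hge ⟨α, hRt, BB_of_absK_lt (hlt.le.trans ?_)⟩
  rw [ht, ← Real.rpow_natCast, ← Real.rpow_mul qq_pos.le, ← Real.rpow_intCast]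
  apply Real.rpow_le_rpow_of_exponent_le one_lt_qq.le
  rw [Int.cast_neg, Int.cast_natCast, Nat.cast_add, Nat.cast_mul, Nat.cast_add, Nat.cast_one]
  have h1 : ((t / (j + 1) : ℕ) : ℝ) ≤ (t : ℝ) / ((j : ℝ) + 1) := by
    have := @Nat.cast_div_le ℝ _ _ _ t (j + 1)
    push_cast at this
    exact this
  have h2 : (t : ℝ) / ((j : ℝ) + 1) = t * (1 / ((j : ℝ) + 1)) := by ring
  have h3 : (0 : ℝ) ≤ t := Nat.cast_nonneg _
  nlinarith [mul_le_mul_of_nonneg_left hle h3]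

lemma upper {ξ : K Fq} {n : ℕ} (h : ∀ j, ¬ ∃ᶠ h in Filter.atTop, ξ ∈ (EE n j h : Set (K Fq))) :
    wnstar Fq ξ n ≤ (n : EReal) := by
  apply sSup_le
  rintro _ ⟨w, hw, rfl⟩
  change (w : EReal) ≤ ((n : ℝ) : EReal)
  rw [EReal.coe_le_coe_iff]
  apply le_of_forall_pos_le_add
  intro ε hε
  obtain ⟨j, hj⟩ := exists_nat_one_div_lt hε
  linarith [upper_aux (h j) hw]

lemma lower_aux {ξ : K Fq} {n l : ℕ} (hξ : ¬ IsAlgK Fq ξ)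
    (hgood : ∀ h0, ∃ h, h0 ≤ h ∧ ξ ∉ (Bad (n + 1) h l : Set (K Fq))) {w : ℝ} (hw0 : 0 ≤ w) (hw : w < n + 1) :
    w ∈ wnstarSet Fq ξ (n + 1) := by
  intro hfin
  obtain ⟨N, hN⟩ := exists_mem_BB ξ
  obtain ⟨c, h1, hroot⟩ := root_exists (Fq := Fq) n N l
  have hev : ∀ᶠ h : ℕ in Filter.atTop, ∀ α ∈ {α : K Fq | IsAlgK Fq α ∧ degA Fq α ≤ n + 1 ∧ 0 < absK Fq (ξ - α) ∧
      absK Fq (ξ - α) < HA Fq α ^ (-w - 1)}, qq Fq ^ (-(((n + 2) * h : ℕ) : ℤ)) ≤ absK Fq (ξ - α) := by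
    rw [Filter.eventually_all_finite hfin]
    rintro α ⟨-, -, hpos, -⟩
    obtain ⟨m, hm⟩ := exists_pow_lt_of_lt_one hpos (inv_lt_one_of_one_lt₀ (one_lt_qq (Fq := Fq)))
    filter_upwards [Filter.eventually_ge_atTop m] with h hh
    refine le_trans ?_ hm.le
    rw [inv_pow, zpow_neg, zpow_natCast]
    apply inv_anti₀ (pow_pos qq_pos _)
    exact pow_le_pow_right₀ one_lt_qq.le (by nlinarith)
  have hev2 : ∀ᶠ h : ℕ in Filter.atTop, (c : ℝ) * (w + 1) ≤ h * (n + 1 - w) := by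
    have : Filter.Tendsto (fun h : ℕ => (h : ℝ) * (n + 1 - w)) Filter.atTop Filter.atTop :=
      tendsto_natCast_atTop_atTop.atTop_mul_const (by linarith)
    exact this.eventually_ge_atTop _
  obtain ⟨h0, hh0⟩ := Filter.eventually_atTop.1 ((hev.and hev2).and (Filter.eventually_ge_atTop h1))
  obtain ⟨h, hle, hbad⟩ := hgood h0
  obtain ⟨⟨ha, hb⟩, hc⟩ := hh0 h hle
  obtain ⟨P, hP0, hPd, hPH, α, hPα, hdist⟩ := hroot ξ hN h hc hbad
  have halg : IsAlgK Fq α := ⟨P, hP0, hPα⟩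
  refine absurd hdist (not_lt.2 (ha α ⟨halg, (degA_le hP0 hPα).trans hPd, ?_, ?_⟩))
  · apply absK_pos
    intro h0
    rw [sub_eq_zero] at h0
    exact hξ (h0 ▸ halg)
  · refine hdist.trans_le ?_
    obtain ⟨t, ht, -⟩ := mem_Rt_of_isAlg halg le_rfl
    have hHA : HA Fq α ≤ qq Fq ^ (h + c) := (HA_le hP0 hPα).trans hPH
    have hpos : 0 < HA Fq α := by rw [ht]; exact pow_pos qq_pos _
    refine le_trans ?_ (Real.rpow_le_rpow_of_nonpos hpos hHA (by linarith))
    rw [← Real.rpow_natCast, ← Real.rpow_mul qq_pos.le, ← Real.rpow_intCast]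
    apply Real.rpow_le_rpow_of_exponent_le one_lt_qq.le
    push_cast
    nlinarith

lemma lower {ξ : K Fq} {n l : ℕ} (hξ : ¬ IsAlgK Fq ξ)
    (hgood : ∀ h0, ∃ h, h0 ≤ h ∧ ξ ∉ (Bad (n + 1) h l : Set (K Fq))) :
    ((n + 1 : ℕ) : EReal) ≤ wnstar Fq ξ (n + 1) := by
  change (((n + 1 : ℕ) : ℝ) : EReal) ≤ _
  apply EReal.ge_of_forall_gt_iff_ge.1
  intro z hz
  have hz' : z < n + 1 := by
    have := EReal.coe_lt_coe_iff.1 hz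
    push_cast at this
    exact this
  have : max z 0 ∈ wnstarSet Fq ξ (n + 1) := lower_aux hξ hgood (le_max_right _ _) (max_lt hz' (by positivity))
  refine le_trans (EReal.coe_le_coe_iff.2 (le_max_left z 0)) ?_
  exact le_sSup ⟨_, this, rfl⟩

variable [MeasurableSpace (K Fq)] [BorelSpace (K Fq)] (mu : Measure (K Fq)) [mu.IsAddHaarMeasure]

lemma main_result : mu {ξ : K Fq | ¬ ∀ n : ℕ, 1 ≤ n → wnstar Fq ξ n = (n : EReal)} = 0 := by
  have hsub : {ξ : K Fq | ¬ ∀ n : ℕ, 1 ≤ n → wnstar Fq ξ n = (n : EReal)} ⊆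
      (⋃ n : ℕ, ⋃ j : ℕ, {ξ : K Fq | ∃ᶠ h in Filter.atTop, ξ ∈ (EE n j h : Set (K Fq))}) ∪
      ⋃ n : ℕ, {x : K Fq | ∀ l, ∃ h0, ∀ h, h0 ≤ h → x ∈ Bad n h l} := by
    intro ξ hξ
    by_contra hcon
    rw [Set.mem_union, not_or, Set.mem_iUnion, Set.mem_iUnion, not_exists, not_exists] at hcon
    obtain ⟨hA, hB⟩ := hcon
    have hA' : ∀ n j, ¬ ∃ᶠ h in Filter.atTop, ξ ∈ (EE n j h : Set (K Fq)) := fun n j hh =>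
      hA n (Set.mem_iUnion.2 ⟨j, hh⟩)
    apply hξ
    intro n hn
    obtain ⟨n, rfl⟩ := Nat.exists_eq_add_of_le' hn
    apply le_antisymm (upper (hA' _))
    have hBn := hB (n + 1)
    simp only [Set.mem_ofPred_eq] at hBn
    push Not at hBn
    obtain ⟨l, hl⟩ := hBn
    exact lower (not_isAlg fun n => hA' n 0) hl
  refine measure_mono_null hsub (measure_union_null ?_ ?_)
  · exact measure_iUnion_null fun n => measure_iUnion_null fun j => ae_upper mu n j
  · exact measure_iUnion_null fun n => ae_good mu n

end Final

end

/-- almost all `ξ ∈ F_q((T⁻¹))` (w.r.t. Haar measure) satisfy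
`w_n^*(ξ) = n` for every `n ≥ 1`. -/
theorem almost_all_wnstar_eq_n (Fq : Type) [Field Fq] [Fintype Fq]
    [MeasurableSpace (K Fq)] [BorelSpace (K Fq)]
    (mu : MeasureTheory.Measure (K Fq)) [mu.IsAddHaarMeasure] :
    mu {ξ : K Fq | ¬ ∀ n : ℕ, 1 ≤ n → wnstar Fq ξ n = (n : EReal)} = 0 := by
  exact main_result mu

end
end MahlerKoksmaFq
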